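/- arXiv:1612.00321 — 13 statements merged into one kernel-verified Lean document; each statement's English description precedes it below -/
import Mathlib

section
/- Let M ≥ 1 be an integer, let γ ∈ ℂ, and let B, C be complex matrices of size at least (M+2)×(M+2) (entries B_{i,j}, C_{i,j} indexed from 1) satisfying C_{i,j} = B_{i,j} + γ·B_{i,j+1} for all 1 ≤ i, j ≤ M+1. Then det[B_{i,j}]_{i,j=1}^{M+1} · det[C_{i+1,j+1}]_{i,j=1}^{M} − det[C_{i,j}]_{i,j=1}^{M+1} · det[B_{i+1,j+1}]_{i,j=1}^{M} + γ · det[B_{i,j+1}]_{i,j=1}^{M+1} · det[C_{i+1,j}]_{i,j=1}^{M} = 0. -/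
/-- Row operations from below do not change the determinant. -/
theorem det_aux_row {n : ℕ} (u w : Fin (n + 1) → Fin (n + 1) → ℂ) (k : Fin n → ℂ)
    (h0 : ∀ j, u (Fin.last n) j = w (Fin.last n) j)
    (h1 : ∀ (i : Fin n) j, u i.castSucc j = w i.castSucc j + k i * u i.succ j) :
    (Matrix.of u).det = (Matrix.of w).det := by
  rw [← Matrix.det_submatrix_equiv_self Fin.revPerm (Matrix.of u),
    ← Matrix.det_submatrix_equiv_self Fin.revPerm (Matrix.of w)]
  apply Matrix.det_eq_of_forall_row_eq_smul_add_pred (fun i => k i.rev)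
  · intro j
    simp [h0]
  · intro i j
    simp [Fin.rev_succ, Fin.rev_castSucc, h1]

theorem det_aux_rel {n : ℕ} (v : Fin (n + 1) → Fin n → ℂ) (a : Fin n → ℂ) :
    ∑ i : Fin (n + 1), (-1 : ℂ) ^ (i : ℕ) * (∑ j, v i j * a j) *
      (Matrix.of fun s t : Fin n => v (i.succAbove s) t).det = 0 := by
  let A : Matrix (Fin (n + 1)) (Fin (n + 1)) ℂ :=
    Matrix.of fun i => Fin.cons (∑ j, v i j * a j) (v i)
  have hA : A.det = 0 := by
    apply Matrix.exists_mulVec_eq_zero_iff.mp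
    refine ⟨Fin.cons 1 (fun j => - a j), ?_, ?_⟩
    · intro h
      have := congrFun h 0
      simp at this
    · ext i
      simp [A, Matrix.mulVec, dotProduct, Fin.sum_univ_succ]
  rw [Matrix.det_succ_column_zero] at hA
  rw [← hA]
  refine Finset.sum_congr rfl fun i _ => ?_
  congr 1

theorem det_aux_lin {m : ℕ} (W : ℕ → ℕ → ℂ) : ∃ a : Fin (m + 1) → ℂ, ∀ x : ℕ → ℂ,
    (Matrix.of fun i j : Fin (m + 1) => if i.1 < m then W i j else x j).det =
      ∑ j : Fin (m + 1), x j * a j := by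
  refine ⟨fun j => (-1) ^ (m + j.1) *
    (Matrix.of fun s t : Fin m => W s (j.succAbove t)).det, fun x => ?_⟩
  rw [Matrix.det_succ_row _ (Fin.last m)]
  refine Finset.sum_congr rfl fun j _ => ?_
  have : (Matrix.of fun i j : Fin (m + 1) => if i.1 < m then W i j else x j).submatrix
      (Fin.last m).succAbove j.succAbove = Matrix.of fun s t : Fin m => W s (j.succAbove t) := by
    ext s t
    simp
  rw [this]
  simp
  ring

/-- The three-term relation. -/
theorem det_aux_three {m : ℕ} (W : ℕ → ℕ → ℂ) (q p r : ℕ → ℂ) :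
    (Matrix.of fun i j : Fin (m + 1) => if i.1 < m then W i (j+1) else q (j+1)).det *
      (Matrix.of fun i j : Fin (m + 2) => if i.1 < m then W i j else if i.1 = m then p j else r j).det
    + (-1) ^ m * (
    (Matrix.of fun i j : Fin (m + 1) => if i.1 < m then W i (j+1) else r (j+1)).det *
      (Matrix.of fun i j : Fin (m + 2) => if i.1 = 0 then q j else
        if i.1 < m + 1 then W (i - 1) j else p j).det
    - (Matrix.of fun i j : Fin (m + 1) => if i.1 < m then W i (j+1) else p (j+1)).det *
      (Matrix.of fun i j : Fin (m + 2) => if i.1 = 0 then q j else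
        if i.1 < m + 1 then W (i - 1) j else r j).det) = 0 := by
  obtain ⟨a, ha⟩ := det_aux_lin (m := m) (fun i j => W i (j+1))
  have hW : ∀ k : Fin m, ∑ j : Fin (m+1), W k (j+1) * a j = 0 := by
    intro k
    rw [← ha (fun j => W k (j+1))]
    apply Matrix.det_zero_of_row_eq (i := k.castSucc) (j := Fin.last m)
    · exact (Fin.castSucc_lt_last k).ne
    · ext j
      simp
  have hq := ha (fun j => q (j+1))
  have hp := ha (fun j => p (j+1))
  have hr := ha (fun j => r (j+1))
  rw [hq, hp, hr]
  obtain ⟨g, g0, gW, gp, gr⟩ : ∃ g : ℕ → ℕ → ℂ, g 0 = q ∧ (∀ k, k < m → g (k+1) = W k) ∧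
      g (m+1) = p ∧ g (m+2) = r := by
    refine ⟨fun s => if s = 0 then q else if s < m + 1 then W (s-1) else
      if s = m + 1 then p else r, by simp, ?_, by simp, by simp⟩
    intro k hk
    simp [hk]
  have key := det_aux_rel (n := m + 2) (fun i j => g i j) (Fin.cons 0 a)
  obtain ⟨F, hF⟩ : ∃ F : ℕ → ℂ, ∀ s, F s = ∑ j : Fin (m+1), g s (j+1) * a j := ⟨_, fun _ => rfl⟩
  have hin : ∀ s, ∑ j : Fin (m+2), g s j * (Fin.cons 0 a : Fin (m+2) → ℂ) j = F s := by
    intro s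
    rw [hF, Fin.sum_univ_succ]
    simp only [Fin.cons_zero, Fin.cons_succ, mul_zero, zero_add, Fin.val_succ]
  simp only [hin] at key
  rw [Fin.sum_univ_succ, Fin.sum_univ_castSucc, Fin.sum_univ_castSucc] at key
  rw [Finset.sum_eq_zero (s := (Finset.univ : Finset (Fin m)))] at key
  · have e0 : (Matrix.of fun s t : Fin (m+2) => g ((0 : Fin (m+3)).succAbove s) t) =
      (Matrix.of fun i j : Fin (m + 2) => if i.1 < m then W i j else if i.1 = m then p j else r j) := by
      ext s t
      have := s.2
      simp only [Matrix.of_apply, Fin.zero_succAbove, Fin.val_succ]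
      split_ifs with h1 h2
      · rw [gW _ h1]
      · rw [h2, gp]
      · rw [show s.1 = m + 1 by omega, gr]
    have e1 : (Matrix.of fun s t : Fin (m+2) =>
        g ((Fin.last m).castSucc.succ.succAbove s) t) =
      (Matrix.of fun i j : Fin (m + 2) => if i.1 = 0 then q j else
        if i.1 < m + 1 then W (i - 1) j else r j) := by
      ext s t
      have := s.2
      have hv : ((Fin.last m).castSucc.succ.succAbove s).1 =
          if s.1 < m + 1 then s.1 else s.1 + 1 := by
        simp only [Fin.succAbove, Fin.lt_def, Fin.val_succ, Fin.val_castSucc, Fin.val_last]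
        split_ifs <;> rfl
      simp only [Matrix.of_apply, hv]
      split_ifs with h1 h2 h2
      · rw [h2, g0]
      · rw [← gW (s.1 - 1) (by omega), show s.1 - 1 + 1 = s.1 by omega]
      · omega
      · rw [show s.1 = m + 1 by omega, gr]
    have e2 : (Matrix.of fun s t : Fin (m+2) =>
        g ((Fin.last (m+1)).succ.succAbove s) t) =
      (Matrix.of fun i j : Fin (m + 2) => if i.1 = 0 then q j else
        if i.1 < m + 1 then W (i - 1) j else p j) := by
      ext s t
      have := s.2
      simp only [Matrix.of_apply, Fin.succ_last, Fin.succAbove_last, Fin.val_castSucc]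
      split_ifs with h1 h2
      · rw [h1, g0]
      · rw [← gW (s.1 - 1) (by omega), show s.1 - 1 + 1 = s.1 by omega]
      · rw [show s.1 = m + 1 by omega, gp]
    rw [e0, e1, e2] at key
    simp only [zero_add, Fin.val_succ, Fin.val_castSucc, Fin.val_last, Fin.val_zero, pow_zero,
      one_mul, pow_succ] at key
    have f0 := hF 0
    have f1 := hF (m+1)
    have f2 := hF (m+1+1)
    rw [g0] at f0
    rw [gp] at f1
    rw [gr] at f2
    rw [f0, f1, f2] at key
    linear_combination key
  · intro k _
    have := hF (k+1)
    rw [gW k.1 k.2, hW k] at this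
    simp only [Fin.val_succ, Fin.val_castSucc, this, zero_mul, mul_zero]

/-- Proposition B.1, identity (B.2): for matrices `B`, `C` (indexed from 1)
related by `C i j = B i j + γ * B i (j+1)` for `1 ≤ i, j ≤ M+1`, a quadratic identity among
determinants of contiguous minors holds. -/
theorem det_identity_one (M : ℕ) (hM : 1 ≤ M) (γ : ℂ) (B C : ℕ → ℕ → ℂ)
    (h : ∀ i j : ℕ, 1 ≤ i → i ≤ M + 1 → 1 ≤ j → j ≤ M + 1 →
      C i j = B i j + γ * B i (j + 1)) :
    (Matrix.of fun i j : Fin (M + 1) => B (i.1 + 1) (j.1 + 1)).det *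
        (Matrix.of fun i j : Fin M => C (i.1 + 2) (j.1 + 2)).det -
      (Matrix.of fun i j : Fin (M + 1) => C (i.1 + 1) (j.1 + 1)).det *
        (Matrix.of fun i j : Fin M => B (i.1 + 2) (j.1 + 2)).det +
      γ * (Matrix.of fun i j : Fin (M + 1) => B (i.1 + 1) (j.1 + 2)).det *
        (Matrix.of fun i j : Fin M => C (i.1 + 2) (j.1 + 1)).det = 0 := by
  obtain ⟨m, rfl⟩ : ∃ m, M = m + 1 := ⟨M - 1, by omega⟩
  have key := det_aux_three (m := m) (fun s k => C (k+1) (s+2)) (fun k => C (k+1) 1)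
    (fun k => B (k+1) (m+2)) (fun k => C (k+1) (m+2))
  -- lower minor of `C`, shifted
  have t1 : (Matrix.of fun i j : Fin (m+1) => C (i.1 + 2) (j.1 + 2)).det =
      (Matrix.of fun i j : Fin (m + 1) => if i.1 < m then C (j+1+1) (i+2) else C (j+1+1) (m+2)).det := by
    rw [← Matrix.det_transpose]
    congr 1
    ext i j
    have := i.2
    simp only [Matrix.of_apply, Matrix.transpose_apply]
    split_ifs with hi
    · rfl
    · rw [show i.1 = m by omega]
  have t2 : (Matrix.of fun i j : Fin (m+1+1) => C (i.1 + 1) (j.1 + 1)).det =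
      (Matrix.of fun i j : Fin (m + 2) => if i.1 = 0 then C (j+1) 1 else
        if i.1 < m + 1 then C (j+1) (i-1+2) else C (j+1) (m+2)).det := by
    rw [← Matrix.det_transpose]
    congr 1
    ext i j
    have := i.2
    simp only [Matrix.of_apply, Matrix.transpose_apply]
    split_ifs with hi hi
    · simp [hi]
    · congr 1; omega
    · congr 1; omega
  have t3 : (Matrix.of fun i j : Fin (m+1+1) => B (i.1 + 1) (j.1 + 1)).det =
      (Matrix.of fun i j : Fin (m + 2) => if i.1 = 0 then C (j+1) 1 else
        if i.1 < m + 1 then C (j+1) (i-1+2) else B (j+1) (m+2)).det := by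
    rw [← Matrix.det_transpose]
    apply det_aux_row _ _ (fun _ => -γ)
    · intro j
      simp
    · intro i j
      have := i.2
      have := j.2
      have e := h (j+1) (i+1) (by omega) (by omega) (by omega) (by omega)
      have : (if i.1 = 0 then C (j+1) 1 else
        if i.1 < m + 1 then C (j+1) (i-1+2) else B (j+1) (m+2)) = C (j+1) (i+1) := by
        split_ifs with hi
        · simp [hi]
        · congr 1; omega
      simp only [Fin.val_castSucc, this, Fin.val_succ, Matrix.of_apply]
      rw [e]; ring
  have t4 : (Matrix.of fun i j : Fin (m+1) => B (i.1 + 2) (j.1 + 2)).det =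
      (Matrix.of fun i j : Fin (m + 1) => if i.1 < m then C (j+1+1) (i+2) else B (j+1+1) (m+2)).det := by
    rw [← Matrix.det_transpose]
    apply det_aux_row _ _ (fun _ => -γ)
    · intro j
      simp
    · intro i j
      have := i.2
      have := j.2
      have e := h (j+2) (i+2) (by omega) (by omega) (by omega) (by omega)
      simp only [Fin.val_castSucc, Fin.val_succ, Matrix.of_apply, i.2, if_true]
      rw [e]
      rw [show i.1 + 1 + 2 = i.1 + 2 + 1 by ring]
      ring
  have t5 : γ * (Matrix.of fun i j : Fin (m+1+1) => B (i.1 + 1) (j.1 + 2)).det =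
      (Matrix.of fun i j : Fin (m + 2) => if i.1 < m then C (j+1) (i+2) else
        if i.1 = m then B (j+1) (m+2) else C (j+1) (m+2)).det := by
    have s1 : γ * (Matrix.of fun i j : Fin (m+1+1) => B (i.1 + 1) (j.1 + 2)).det =
        (Matrix.of fun i j : Fin (m + 2) => if i.1 < m + 1 then B (j+1) (i+2) else
          γ * B (j+1) (m+3)).det := by
      rw [← Matrix.det_transpose]
      have := Matrix.det_mul_column (fun i : Fin (m+1+1) => if i.1 < m + 1 then (1:ℂ) else γ)
        (Matrix.of fun i j : Fin (m+1+1) => B (i.1 + 1) (j.1 + 2)).transpose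
      rw [Fin.prod_univ_castSucc] at this
      simp only [Fin.val_castSucc, Fin.is_lt, if_true, Finset.prod_const_one, Fin.val_last,
        lt_irrefl, if_false, one_mul] at this
      rw [← this]
      congr 1
      ext i j
      have := i.2
      simp only [Matrix.of_apply, Matrix.transpose_apply]
      split_ifs with hi
      · simp
      · rw [show i.1 = m + 1 by omega]
    have s2 : (Matrix.of fun i j : Fin (m + 2) => if i.1 < m + 1 then B (j+1) (i+2) else
          γ * B (j+1) (m+3)).det =
        (Matrix.of fun i j : Fin (m + 2) => if i.1 < m then C (j+1) (i+2) else
        if i.1 = m then B (j+1) (m+2) else γ * B (j+1) (m+3)).det := by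
      apply det_aux_row _ _ (fun i => if i.1 < m then -γ else 0)
      · intro j
        simp
      · intro i j
        have := i.2
        have := j.2
        have e := h (j+1) (i+2) (by omega) (by omega) (by omega) 
        by_cases hi : i.1 < m
        · simp [hi, i.2, e (by omega)]
        · have : i.1 = m := by omega
          simp [this]
    rw [s1, s2]
    symm
    apply Matrix.det_eq_of_forall_row_eq_smul_add_pred (fun i => if i.1 < m then 0 else 1)
    · intro j
      rcases Nat.eq_zero_or_pos m with hm | hm
      · simp [hm]
      · simp [hm]
    · intro i j
      have := i.2
      have := j.2
      by_cases hi : i.1 < m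
      · have : i.1 + 1 < m ∨ i.1 + 1 = m := by omega
        rcases this with h' | h' <;> simp [hi, h']
      · have : i.1 = m := by omega
        have e := h (j+1) (m+2) (by omega) (by omega) (by omega) (by omega)
        simp [this, e]
        try ring
  have t6 : (Matrix.of fun i j : Fin (m+1) => C (i.1 + 2) (j.1 + 1)).det = (-1) ^ m *
      (Matrix.of fun i j : Fin (m + 1) => if i.1 < m then C (j+1+1) (i+2) else C (j+1+1) 1).det := by
    have := Matrix.det_permute (finRotate (m+1)) 
      (Matrix.of fun i j : Fin (m+1) => C (i.1 + 2) (j.1 + 1)).transpose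
    rw [sign_finRotate, Matrix.det_transpose] at this
    have e : ((Matrix.of fun i j : Fin (m+1) => C (i.1 + 2) (j.1 + 1)).transpose.submatrix
        (finRotate (m+1)) id) = 
        (Matrix.of fun i j : Fin (m + 1) => if i.1 < m then C (j+1+1) (i+2) else C (j+1+1) 1) := by
      ext i j
      have := i.2
      simp only [Matrix.of_apply, Matrix.transpose_apply, Matrix.submatrix_apply, id]
      split_ifs with hi
      · rw [coe_finRotate_of_ne_last]
        intro h'
        simp [h'] at hi
      · have : i = Fin.last m := by ext; simp; omega
        simp [this]
    rw [e] at this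
    rw [this, ← mul_assoc]
    push_cast
    rw [← mul_pow]
    simp
  rw [t1, t2, t3, t4, t5, t6]
  have sq : ((-1 : ℂ) ^ m) * (-1) ^ m = 1 := by rw [← mul_pow]; simp
  have fin : ∀ s x y z w u v : ℂ, s * s = 1 → x * y + s * (z * w - u * v) = 0 →
      w * z - v * u + y * (s * x) = 0 := by
    intro s x y z w u v hs hk
    linear_combination s * hk - (z * w - u * v) * hs
  exact fin _ _ _ _ _ _ _ sq key
end

section
/- Let M ≥ 1 be an integer, let γ ∈ ℂ, and let B, C be complex matrices of size at least (M+2)×(M+2) (entries B_{i,j}, C_{i,j} indexed from 1) satisfying C_{i,j} = B_{i,j} + γ·B_{i,j+1} for all 1 ≤ i, j ≤ M+1. Then det[B_{i,j}]_{i,j=1}^{M+1} · det[C_{i+1,j+1}]_{i,j=1}^{M−1} − det[C_{i,j}]_{i,j=1}^{M} · det[B_{i+1,j+1}]_{i,j=1}^{M} + det[B_{i,j+1}]_{i,j=1}^{M} · det[C_{i+1,j}]_{i,j=1}^{M} = 0. -/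
open Matrix in
lemma jacobi_block_aux {R : Type*} [CommRing R] {n : ℕ}
    (A : Matrix (Fin 2 ⊕ Fin n) (Fin 2 ⊕ Fin n) R) :
    A.det * A.adjugate.toBlocks₁₁.det = A.det * (A.det * A.toBlocks₂₂.det) := by
  have h1 := mul_adjugate A
  set X := A.adjugate with hX
  have key : A * fromBlocks X.toBlocks₁₁ 0 X.toBlocks₂₁ 1
      = fromBlocks (A.det • (1 : Matrix (Fin 2) (Fin 2) R)) A.toBlocks₁₂ 0 A.toBlocks₂₂ := by
    have h2 := h1
    set d := A.det
    rw [← fromBlocks_toBlocks A, ← fromBlocks_toBlocks X, fromBlocks_multiply,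
      ← fromBlocks_one, fromBlocks_smul, fromBlocks_inj] at h2
    obtain ⟨ha, -, hc, -⟩ := h2
    conv_lhs => rw [← fromBlocks_toBlocks A, fromBlocks_multiply]
    rw [ha, hc]
    simp
  have h3 := congrArg det key
  rw [det_mul, det_fromBlocks_zero₁₂, det_fromBlocks_zero₂₁, det_smul] at h3
  simp only [det_one, mul_one, Fintype.card_fin] at h3
  rw [h3]; ring

open Matrix in
lemma jacobi_block {R : Type*} [CommRing R] {n : ℕ}
    (A : Matrix (Fin 2 ⊕ Fin n) (Fin 2 ⊕ Fin n) R) :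
    A.adjugate.toBlocks₁₁.det = A.det * A.toBlocks₂₂.det := by
  have h := mul_left_cancel₀ (det_mvPolynomialX_ne_zero (Fin 2 ⊕ Fin n) ℤ)
    (jacobi_block_aux (mvPolynomialX (Fin 2 ⊕ Fin n) (Fin 2 ⊕ Fin n) ℤ))
  set f : MvPolynomial ((Fin 2 ⊕ Fin n) × (Fin 2 ⊕ Fin n)) ℤ →ₐ[ℤ] R :=
    MvPolynomial.aeval fun p => A p.1 p.2
  have hA := mvPolynomialX_mapMatrix_aeval ℤ A
  have h' := congrArg f h
  rw [map_mul, AlgHom.map_det, AlgHom.map_det, AlgHom.map_det, hA] at h'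
  have e1 : f.mapMatrix (mvPolynomialX (Fin 2 ⊕ Fin n) (Fin 2 ⊕ Fin n) ℤ).adjugate.toBlocks₁₁
      = A.adjugate.toBlocks₁₁ := by
    conv_rhs => rw [← hA, ← AlgHom.map_adjugate]
    rfl
  have e2 : f.mapMatrix (mvPolynomialX (Fin 2 ⊕ Fin n) (Fin 2 ⊕ Fin n) ℤ).toBlocks₂₂
      = A.toBlocks₂₂ := by
    conv_rhs => rw [← hA]
    rfl
  rw [e1, e2] at h'
  exact h'

lemma endsMap_bijective (n : ℕ) : Function.Bijective
    (Sum.elim ![0, Fin.last (n + 1)] (fun k : Fin n => k.succ.castSucc) :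
      Fin 2 ⊕ Fin n → Fin (n + 2)) := by
  rw [Fintype.bijective_iff_injective_and_card]
  refine ⟨?_, by simp; omega⟩
  rintro (a | a) (b | b) h
  · fin_cases a <;> fin_cases b <;> simp_all [Fin.ext_iff]
  · fin_cases a <;> simp [Fin.ext_iff] at h
    omega
  · fin_cases b <;> simp [Fin.ext_iff] at h
    omega
  · simp [Fin.ext_iff] at h
    simp [Fin.ext_iff, h]

open Matrix in
lemma desnanot_jacobi {R : Type*} [CommRing R] {n : ℕ}
    (A : Matrix (Fin (n + 2)) (Fin (n + 2)) R) :
    A.det * (A.submatrix (fun k : Fin n => k.succ.castSucc) (fun k : Fin n => k.succ.castSucc)).det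
      = (A.submatrix Fin.succ Fin.succ).det * (A.submatrix Fin.castSucc Fin.castSucc).det
        - (A.submatrix Fin.castSucc Fin.succ).det * (A.submatrix Fin.succ Fin.castSucc).det := by
  let e : Fin 2 ⊕ Fin n ≃ Fin (n + 2) := Equiv.ofBijective _ (endsMap_bijective n)
  have h := jacobi_block (A.submatrix e e)
  rw [adjugate_submatrix_equiv_self, det_submatrix_equiv_self] at h
  have e2 : (A.submatrix e e).toBlocks₂₂ =
    (A.submatrix (fun k : Fin n => k.succ.castSucc) (fun k : Fin n => k.succ.castSucc)) := rfl
  rw [e2] at h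
  rw [← h, det_fin_two]
  have hs : (Fin.succAbove (0 : Fin (n + 2))) = Fin.succ := by ext; simp
  have hl : (Fin.succAbove (Fin.last (n + 1))) = Fin.castSucc := by ext; simp
  have e00 : (A.adjugate.submatrix e e).toBlocks₁₁ 0 0 = A.adjugate 0 0 := rfl
  have e01 : (A.adjugate.submatrix e e).toBlocks₁₁ 0 1 = A.adjugate 0 (Fin.last _) := rfl
  have e10 : (A.adjugate.submatrix e e).toBlocks₁₁ 1 0 = A.adjugate (Fin.last _) 0 := rfl
  have e11 : (A.adjugate.submatrix e e).toBlocks₁₁ 1 1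
    = A.adjugate (Fin.last _) (Fin.last _) := rfl
  rw [e00, e01, e10, e11]
  simp only [adjugate_fin_succ_eq_det_submatrix, hs, hl, Fin.val_zero, Fin.val_last]
  have hm : ((-1 : R) ^ (n + 1)) * (-1) ^ (n + 1) = 1 := by
    rw [← mul_pow]; simp
  have hm2 : ((-1 : R) ^ (n + 1 + (n + 1))) = 1 := by
    rw [pow_add, hm]
  rw [hm2]
  simp only [add_zero, zero_add, pow_zero, one_mul]
  linear_combination (-(A.submatrix Fin.castSucc Fin.succ).det *
    (A.submatrix Fin.succ Fin.castSucc).det) * hm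

open Matrix in
lemma det_col_op {R : Type*} [CommRing R] {n : ℕ} (γ : R)
    (A N : Matrix (Fin (n + 1)) (Fin (n + 1)) R)
    (hl : ∀ i, N i (Fin.last n) = A i (Fin.last n))
    (hc : ∀ i (j : Fin n), N i j.castSucc = A i j.castSucc + γ * A i j.succ) :
    N.det = A.det := by
  rw [← det_submatrix_equiv_self Fin.revPerm A, ← det_submatrix_equiv_self Fin.revPerm N]
  symm
  apply det_eq_of_forall_col_eq_smul_add_pred (fun _ => -γ)
  · intro i
    simp [hl]
  · intro i j
    simp only [submatrix_apply, Fin.revPerm_apply, Fin.rev_succ, Fin.rev_castSucc, hc]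
    ring

/-- Proposition B.1, identity (B.3): for matrices `B`, `C` (indexed from 1)
related by `C i j = B i j + γ * B i (j+1)` for `1 ≤ i, j ≤ M+1`, a second quadratic identity
among determinants of contiguous minors holds. -/
theorem det_identity_two (M : ℕ) (hM : 1 ≤ M) (γ : ℂ) (B C : ℕ → ℕ → ℂ)
    (h : ∀ i j : ℕ, 1 ≤ i → i ≤ M + 1 → 1 ≤ j → j ≤ M + 1 →
      C i j = B i j + γ * B i (j + 1)) :
    (Matrix.of fun i j : Fin (M + 1) => B (i.1 + 1) (j.1 + 1)).det *
        (Matrix.of fun i j : Fin (M - 1) => C (i.1 + 2) (j.1 + 2)).det -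
      (Matrix.of fun i j : Fin M => C (i.1 + 1) (j.1 + 1)).det *
        (Matrix.of fun i j : Fin M => B (i.1 + 2) (j.1 + 2)).det +
      (Matrix.of fun i j : Fin M => B (i.1 + 1) (j.1 + 2)).det *
        (Matrix.of fun i j : Fin M => C (i.1 + 2) (j.1 + 1)).det = 0 := by
  obtain ⟨n, rfl⟩ : ∃ n, M = n + 1 := ⟨M - 1, by omega⟩
  let N : Matrix (Fin (n + 2)) (Fin (n + 2)) ℂ := Matrix.of fun i j =>
    if j = Fin.last (n + 1) then B (i.1 + 1) (j.1 + 1) else C (i.1 + 1) (j.1 + 1)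
  have hN : ∀ i (j : Fin (n + 1)), N i j.castSucc = C (i.1 + 1) (j.1 + 1) := by
    intro i j
    simp [N, (Fin.castSucc_lt_last j).ne]
  have hNl : ∀ i, N i (Fin.last (n + 1)) = B (i.1 + 1) (n + 2) := by
    intro i
    simp [N]
  have hC : ∀ (i : ℕ) (j : Fin (n + 1)), i ≤ n + 1 →
      C (i + 1) (j.1 + 1) = B (i + 1) (j.1 + 1) + γ * B (i + 1) (j.1 + 2) := by
    intro i j hi
    exact h _ _ (by omega) (by omega) (by omega) (by omega)
  have hD := desnanot_jacobi N
  have h1 : N.det = (Matrix.of fun i j : Fin (n + 1 + 1) => B (i.1 + 1) (j.1 + 1)).det := by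
    apply det_col_op γ
    · intro i
      simp [hNl]
    · intro i j
      rw [hN, hC _ _ (by omega)]
      simp
  have hsc : ∀ i (j : Fin n), N i j.castSucc.succ = C (i.1 + 1) (j.1 + 2) := by
    intro i j
    rw [Fin.succ_castSucc, hN]
    simp
  have h2 : (N.submatrix Fin.succ Fin.succ).det =
      (Matrix.of fun i j : Fin (n + 1) => B (i.1 + 2) (j.1 + 2)).det := by
    apply det_col_op γ
    · intro i
      simp [hNl]
    · intro i j
      rw [Matrix.submatrix_apply, hsc]
      have := hC (i.1 + 1) j.succ (by omega)
      simpa using this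
  have h3 : (N.submatrix Fin.castSucc Fin.succ).det =
      (Matrix.of fun i j : Fin (n + 1) => B (i.1 + 1) (j.1 + 2)).det := by
    apply det_col_op γ
    · intro i
      simp [hNl]
    · intro i j
      rw [Matrix.submatrix_apply, hsc]
      have := hC i.1 j.succ (by omega)
      simpa using this
  have h4 : N.submatrix Fin.castSucc Fin.castSucc =
      Matrix.of fun i j : Fin (n + 1) => C (i.1 + 1) (j.1 + 1) := by
    ext i j
    simp [hN]
  have h5 : N.submatrix Fin.succ Fin.castSucc =
      Matrix.of fun i j : Fin (n + 1) => C (i.1 + 2) (j.1 + 1) := by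
    ext i j
    simp [hN]
  have h6 : N.submatrix (fun k : Fin n => k.succ.castSucc) (fun k : Fin n => k.succ.castSucc) =
      Matrix.of fun i j : Fin n => C (i.1 + 2) (j.1 + 2) := by
    ext i j
    simp [hsc]
  rw [h1, h2, h3, h4, h5, h6] at hD
  have h7 : (Matrix.of fun i j : Fin (n + 1 - 1) => C (i.1 + 2) (j.1 + 2)).det =
      (Matrix.of fun i j : Fin n => C (i.1 + 2) (j.1 + 2)).det := rfl
  rw [h7]
  linear_combination hD
end

section
/- Let φ : ℤ → ℂ, γ ∈ ℂ, and M ≥ 1 an integer. Define the sequences ψ(k) = φ(k) + γ·φ(k−1) (the Toeplitz symbol (1+γz)φ(z)), σ(k) = φ(k−1) (the symbol z·φ(z)), and χ(k) = φ(k+1) + γ·φ(k) (the symbol (1+γz)z^{−1}φ(z)). Then D_{M+1}(φ)·D_M(ψ) − D_{M+1}(ψ)·D_M(φ) + γ·D_{M+1}(σ)·D_M(χ) = 0. -/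
/-- The `M × M` Toeplitz determinant `det[f(i-j)]_{i,j=1}^M` of a symbol with Fourier
coefficients `f : ℤ → ℂ`, with the convention that the `0 × 0` determinant equals `1`. -/
noncomputable def toeplitzDet (M : ℕ) (f : ℤ → ℂ) : ℂ :=
  (Matrix.of fun i j : Fin M => f ((i : ℤ) - (j : ℤ))).det

/-- Lemma B.2, identity (B.4): the Toeplitz determinant identity
`D_{M+1}(φ) D_M((1+γz)φ) − D_{M+1}((1+γz)φ) D_M(φ) + γ D_{M+1}(zφ) D_M((1+γz)z⁻¹φ) = 0`,
expressed via the Fourier coefficients of the symbols. -/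
theorem toeplitz_identity (M : ℕ) (hM : 1 ≤ M) (γ : ℂ) (φ ψ σ χ : ℤ → ℂ)
    (hψ : ∀ k : ℤ, ψ k = φ k + γ * φ (k - 1))
    (hσ : ∀ k : ℤ, σ k = φ (k - 1))
    (hχ : ∀ k : ℤ, χ k = φ (k + 1) + γ * φ k) :
    toeplitzDet (M + 1) φ * toeplitzDet M ψ - toeplitzDet (M + 1) ψ * toeplitzDet M φ +
      γ * toeplitzDet (M + 1) σ * toeplitzDet M χ = 0 := by
  unfold toeplitzDet
  set B : Matrix (Fin (M+1)) (Fin (M+1)) ℂ := Matrix.of fun i j => φ ((i : ℤ) - (j : ℤ)) with hB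
  set A : Matrix (Fin (M+1)) (Fin (M+1)) ℂ := Matrix.of fun i j => ψ ((i : ℤ) - (j : ℤ)) with hA
  set S : Matrix (Fin (M+1)) (Fin (M+1)) ℂ := Matrix.of fun i j => σ ((i : ℤ) - (j : ℤ)) with hS
  have hAB : A = B + γ • S := by
    ext i j
    simp [hA, hB, hS, hψ, hσ]
  have hBS : ∀ (i : Fin (M+1)) (k : Fin M), S i k.castSucc = B i k.succ := by
    intro i k
    simp only [hB, hS, hσ, Matrix.of_apply, Fin.val_castSucc, Fin.val_succ]
    congr 1
    push_cast
    ring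
  -- pairing of the adjugate of `B` with the columns of `S`
  have h1 : ∀ k : Fin M, (B.adjugate * S) 0 k.castSucc = 0 := by
    intro k
    have h : (B.adjugate * S) 0 k.castSucc = (B.adjugate * B) 0 k.succ := by
      simp only [Matrix.mul_apply, hBS]
    rw [h, Matrix.adjugate_mul]
    simp [Matrix.one_apply, (Fin.succ_ne_zero k).symm]
  have h2 : (B.adjugate * S) 0 (Fin.last M) = (-1) ^ M * S.det := by
    rw [Matrix.det_succ_column S (Fin.last M), Matrix.mul_apply, Finset.mul_sum]
    refine Finset.sum_congr rfl fun i _ => ?_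
    rw [Matrix.adjugate_fin_succ_eq_det_submatrix]
    have h : S.submatrix i.succAbove (Fin.last M).succAbove
        = B.submatrix i.succAbove (0 : Fin (M+1)).succAbove := by
      ext a b
      simp [hBS]
    rw [h]
    have e : ((-1 : ℂ)) ^ M * (-1) ^ M = 1 := by rw [← mul_pow]; simp
    simp only [Fin.val_last, Fin.val_zero, pow_add, pow_zero]
    linear_combination (-(-1 : ℂ) ^ (i : ℕ) * S i (Fin.last M) *
      (B.submatrix i.succAbove (0 : Fin (M+1)).succAbove).det) * e
  have key : (B.adjugate * A * A.adjugate) 0 0 = A.det * B.adjugate 0 0 := by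
    rw [Matrix.mul_assoc, Matrix.mul_adjugate]
    simp
  have hBA : B.adjugate * A = B.det • (1 : Matrix _ _ ℂ) + γ • (B.adjugate * S) := by
    rw [hAB, Matrix.mul_add, Matrix.adjugate_mul, Matrix.mul_smul]
  have h3 : (B.adjugate * A * A.adjugate) 0 0 =
      B.det * A.adjugate 0 0 + γ * ((-1) ^ M * S.det) * A.adjugate (Fin.last M) 0 := by
    rw [hBA, Matrix.add_mul, Matrix.smul_mul, Matrix.smul_mul, Matrix.one_mul]
    simp only [Matrix.add_apply, Matrix.smul_apply, smul_eq_mul]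
    rw [Matrix.mul_apply, Fin.sum_univ_castSucc]
    simp only [h1, h2]
    simp
    ring
  have hb : B.adjugate 0 0 = (Matrix.of fun i j : Fin M => φ ((i : ℤ) - (j : ℤ))).det := by
    rw [Matrix.adjugate_fin_succ_eq_det_submatrix]
    simp only [Fin.val_zero, add_zero, pow_zero, one_mul]
    congr 1
    ext a b
    simp [hB]
  have ha : A.adjugate 0 0 = (Matrix.of fun i j : Fin M => ψ ((i : ℤ) - (j : ℤ))).det := by
    rw [Matrix.adjugate_fin_succ_eq_det_submatrix]
    simp only [Fin.val_zero, add_zero, pow_zero, one_mul]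
    congr 1
    ext a b
    simp [hA]
  have hl : A.adjugate (Fin.last M) 0 =
      (-1) ^ M * (Matrix.of fun i j : Fin M => χ ((i : ℤ) - (j : ℤ))).det := by
    rw [Matrix.adjugate_fin_succ_eq_det_submatrix]
    simp only [Fin.val_zero, zero_add, Fin.val_last]
    congr 2
    ext a b
    simp only [hA, hψ, hχ, Matrix.submatrix_apply, Matrix.of_apply, Fin.succAbove_zero,
      Fin.succAbove_last, Fin.val_succ, Fin.val_castSucc]
    push_cast
    ring_nf
  have e : ((-1 : ℂ)) ^ M * (-1) ^ M = 1 := by rw [← mul_pow]; simp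
  rw [h3, ha, hb, hl] at key
  linear_combination key - γ * S.det *
    (Matrix.of fun i j : Fin M => χ ((i : ℤ) - (j : ℤ))).det * e
end

section
/- Let n ≥ r ≥ 1 be integers, τ ∈ ℝ, and let Γ be a positively oriented circle in ℂ with 0 ∉ Γ and with nonzero complex numbers a_1, …, a_n not lying on Γ. Then the r-fold iterated contour integral ((−1)^{r(r+1)/2} / ((2πi)^r · r!)) ∮_Γ ⋯ ∮_Γ ∏_{1≤k<ℓ≤r} (z_k − z_ℓ)^2 · ∏_{k=1}^{r} [ z_k^{−r} · ∏_{ℓ=1}^{n} a_ℓ/(a_ℓ − z_k) · e^{−τ z_k} ] dz_1 ⋯ dz_r equals the Toeplitz determinant det[A(i−j)]_{i,j=1}^{r}, where A(s) = −(1/(2πi)) ∮_Γ z^{s−1} · ∏_{ℓ=1}^{n} a_ℓ/(a_ℓ − z) · e^{−τ z} dz for s ∈ ℤ. -/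
/-- The `r`-fold iterated contour integral `∮_Γ ⋯ ∮_Γ f(z₁,…,z_r) dz₁ ⋯ dz_r`, all variables
running over the positively oriented circle of center `c` and radius `R`. -/
noncomputable def iterCircleIntegral (c : ℂ) (R : ℝ) : (r : ℕ) → ((Fin r → ℂ) → ℂ) → ℂ
  | 0, f => f (fun i => i.elim0)
  | r + 1, f => ∮ z in C(c, R), iterCircleIntegral c R r fun v => f (Fin.cons z v)

theorem iter_sum {ι : Type*} (c : ℂ) (R : ℝ) (S : Finset ι) :
    ∀ (r : ℕ) (C : ι → ℂ) (g : ι → Fin r → ℂ → ℂ)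
      (_ : ∀ s k, CircleIntegrable (g s k) c R),
      iterCircleIntegral c R r (fun z => ∑ s ∈ S, C s * ∏ k, g s k (z k)) =
        ∑ s ∈ S, C s * ∏ k, ∮ z in C(c, R), g s k z := by
  intro r
  induction r with
  | zero => intro C g _; simp [iterCircleIntegral]
  | succ r ih =>
    intro C g hg
    have h1 : ∀ z : ℂ, iterCircleIntegral c R r (fun v => ∑ s ∈ S, C s *
        ∏ k, g s k ((Fin.cons z v : Fin (r+1) → ℂ) k)) =
        ∑ s ∈ S, (C s * ∏ k : Fin r, ∮ z in C(c, R), g s k.succ z) * g s 0 z := by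
      intro z
      have := ih (fun s => C s * g s 0 z) (fun s k => g s k.succ) (fun s k => hg s k.succ)
      simp only [Fin.prod_univ_succ, Fin.cons_zero, Fin.cons_succ, ← mul_assoc]
      rw [this]
      exact Finset.sum_congr rfl fun s _ => by ring
    simp only [iterCircleIntegral, h1]
    rw [circleIntegral.integral_fun_sum]
    · refine Finset.sum_congr rfl fun s _ => ?_
      rw [circleIntegral.integral_const_mul, Fin.prod_univ_succ]
      ring
    · intro s _
      exact IntervalIntegrable.const_mul (hg s 0) _

theorem sum_sum_det {r : ℕ} (H : Matrix (Fin r) (Fin r) ℂ) :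
    ∑ p : Equiv.Perm (Fin r) × Equiv.Perm (Fin r),
      (((Equiv.Perm.sign p.1 : ℤ) : ℂ) * ((Equiv.Perm.sign p.2 : ℤ) : ℂ)) *
        ∏ k, H (p.1 k) (p.2 k) = (r.factorial : ℂ) * H.det := by
  rw [Fintype.sum_prod_type]
  have : ∀ σ : Equiv.Perm (Fin r), ∑ ρ : Equiv.Perm (Fin r),
      (((Equiv.Perm.sign σ : ℤ) : ℂ) * ((Equiv.Perm.sign ρ : ℤ) : ℂ)) *
        ∏ k, H (σ k) (ρ k) = H.det := by
    intro σ
    have h := Matrix.det_permute σ H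
    rw [← Matrix.det_transpose, Matrix.det_apply'] at h
    simp only [mul_assoc, ← Finset.mul_sum]
    simp only [Matrix.transpose_apply, Matrix.submatrix_apply, id] at h
    rw [h, ← mul_assoc]
    rcases Int.units_eq_one_or (Equiv.Perm.sign σ) with h | h <;> simp [h]
  simp [this, Fintype.card_perm]

theorem pair_prod {r : ℕ} (f : Fin r → Fin r → ℂ) :
    ∏ p ∈ Finset.univ.filter (fun p : Fin r × Fin r => p.1 < p.2), f p.1 p.2 =
      ∏ i, ∏ j ∈ Finset.Ioi i, f i j := by
  rw [Finset.prod_filter, Fintype.prod_prod_type]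
  refine Finset.prod_congr rfl fun i _ => ?_
  rw [← Finset.prod_filter]
  congr 1
  ext; simp

theorem pair_sign (r : ℕ) :
    (-1 : ℂ) ^ r * ∏ i : Fin r, ∏ _j ∈ Finset.Ioi i, (-1 : ℂ) = (-1) ^ (r * (r + 1) / 2) := by
  simp only [Finset.prod_const, Fin.card_Ioi]
  rw [Finset.prod_pow_eq_pow_sum, ← pow_add]
  congr 1
  rw [Fin.sum_univ_eq_sum_range (fun i => r - 1 - i) r, Finset.sum_range_reflect (fun i => i) r,
    add_comm, ← Finset.sum_range_succ (fun i => i), Finset.sum_range_id, mul_comm]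
  simp

theorem vand_sq {r : ℕ} (z : Fin r → ℂ) :
    (-1 : ℂ) ^ (r * (r + 1) / 2) *
      (∏ p ∈ Finset.univ.filter (fun p : Fin r × Fin r => p.1 < p.2), (z p.1 - z p.2) ^ 2) =
    (-1) ^ r * ∑ p : Equiv.Perm (Fin r) × Equiv.Perm (Fin r),
      (((Equiv.Perm.sign p.1 : ℤ) : ℂ) * ((Equiv.Perm.sign p.2 : ℤ) : ℂ)) *
        ∏ k, (z k ^ (p.1 k : ℕ) * z k ^ ((p.2 k).rev : ℕ)) := by
  have h1 := Matrix.det_vandermonde z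
  have h2 := Matrix.det_projVandermonde (fun _ => (1:ℂ)) z
  rw [← Matrix.det_transpose, Matrix.det_apply'] at h1 h2
  simp only [Matrix.transpose_apply, Matrix.vandermonde_apply, Matrix.projVandermonde_apply,
    one_pow, one_mul] at h1 h2
  rw [Fintype.sum_prod_type]
  have : ∀ σ ρ : Equiv.Perm (Fin r), (((Equiv.Perm.sign σ : ℤ) : ℂ) * ((Equiv.Perm.sign ρ : ℤ) : ℂ)) *
        ∏ k, (z k ^ (σ k : ℕ) * z k ^ ((ρ k).rev : ℕ)) =
      (((Equiv.Perm.sign σ : ℤ) : ℂ) * ∏ k, z k ^ (σ k : ℕ)) *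
      (((Equiv.Perm.sign ρ : ℤ) : ℂ) * ∏ k, z k ^ ((ρ k).rev : ℕ)) := by
    intro σ ρ; rw [Finset.prod_mul_distrib]; ring
  simp only [this]
  rw [← Finset.sum_mul_sum, h1, h2, pair_prod (fun i j => (z i - z j) ^ 2), ← pair_sign, mul_assoc]
  simp only [← Finset.prod_mul_distrib]
  congr 1
  refine Finset.prod_congr rfl fun i _ => Finset.prod_congr rfl fun j _ => ?_
  ring

theorem iter_const_mul (c : ℂ) (R : ℝ) (b : ℂ) : ∀ (r : ℕ) (f : (Fin r → ℂ) → ℂ),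
    b * iterCircleIntegral c R r f = iterCircleIntegral c R r (fun z => b * f z) := by
  intro r
  induction r with
  | zero => intro f; rfl
  | succ r ih =>
    intro f
    simp only [iterCircleIntegral, ← ih]
    rw [circleIntegral.integral_const_mul]

/-- Lemma 3.3, Plancherel case: the `r`-fold contour integral expression for
`e^{-(x^{(n)}_n + ⋯ + x^{(n)}_{n-r+1})}` equals the Toeplitz determinant `det[A(i-j)]_{i,j=1}^r`
with symbol coefficients `A(s) = -(1/(2πi)) ∮_Γ z^{s-1} ∏_{ℓ=1}^n a_ℓ/(a_ℓ-z) e^{-τz} dz`. -/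
theorem iterIntegral_eq_toeplitzDet (n r : ℕ) (hr : 1 ≤ r) (hrn : r ≤ n) (τ : ℝ)
    (c : ℂ) (R : ℝ) (hR : 0 < R) (h0 : (0 : ℂ) ∉ Metric.sphere c R)
    (a : ℕ → ℂ) (ha : ∀ ℓ : ℕ, 1 ≤ ℓ → ℓ ≤ n → a ℓ ≠ 0 ∧ a ℓ ∉ Metric.sphere c R) :
    ((-1 : ℂ) ^ (r * (r + 1) / 2) / ((2 * (Real.pi : ℂ) * Complex.I) ^ r * (r.factorial : ℂ))) *
        iterCircleIntegral c R r (fun z =>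
          (∏ p ∈ Finset.univ.filter (fun p : Fin r × Fin r => p.1 < p.2), (z p.1 - z p.2) ^ 2) *
            ∏ k : Fin r, (z k ^ (-(r : ℤ)) *
              (∏ ℓ ∈ Finset.Icc 1 n, a ℓ / (a ℓ - z k)) * Complex.exp (-(τ : ℂ) * z k))) =
      (Matrix.of fun i j : Fin r =>
        -(1 / (2 * (Real.pi : ℂ) * Complex.I)) *
          ∮ z in C(c, R), z ^ (((i : ℤ) - (j : ℤ)) - 1) *
            (∏ ℓ ∈ Finset.Icc 1 n, a ℓ / (a ℓ - z)) * Complex.exp (-(τ : ℂ) * z)).det := by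
  set w : ℂ → ℂ := fun z => (∏ ℓ ∈ Finset.Icc 1 n, a ℓ / (a ℓ - z)) * Complex.exp (-(τ : ℂ) * z)
    with hw
  have hz : ∀ z ∈ Metric.sphere c R, z ≠ 0 := fun z hz h => h0 (h ▸ hz)
  have hwc : ContinuousOn w (Metric.sphere c R) := by
    refine ContinuousOn.mul (continuousOn_finsetProd _ fun ℓ hℓ => ?_) (by fun_prop)
    refine ContinuousOn.div (by fun_prop) (by fun_prop) fun z hz h => ?_
    rw [Finset.mem_Icc] at hℓ
    exact (ha ℓ hℓ.1 hℓ.2).2 (sub_eq_zero.1 h ▸ hz)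
  have hzc : ∀ m : ℤ, ContinuousOn (fun z : ℂ => z ^ m) (Metric.sphere c R) := fun m =>
    ContinuousOn.zpow₀ continuousOn_id m fun z h => Or.inl (hz z h)
  let G : Fin r → Fin r → ℂ → ℂ := fun i j z =>
    (z ^ (i : ℕ) * z ^ (j.rev : ℕ)) * (z ^ (-(r : ℤ)) * w z)
  have hG : ∀ i j, CircleIntegrable (G i j) c R := fun i j =>
    ContinuousOn.circleIntegrable hR.le
      (ContinuousOn.mul (by fun_prop) ((hzc _).mul hwc))
  have hint : ∀ i j : Fin r, (∮ z in C(c, R), z ^ (((i : ℤ) - (j : ℤ)) - 1) *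
            (∏ ℓ ∈ Finset.Icc 1 n, a ℓ / (a ℓ - z)) * Complex.exp (-(τ : ℂ) * z)) =
      ∮ z in C(c, R), G i j z := by
    intro i j
    refine circleIntegral.integral_congr hR.le fun z h => ?_
    have hz0 := hz z h
    simp only [G, hw]
    rw [← zpow_natCast, ← zpow_natCast, ← zpow_add₀ hz0, ← mul_assoc, ← mul_assoc,
      ← zpow_add₀ hz0]
    congr 3
    rw [Fin.val_rev]
    have := j.2
    push_cast [Nat.cast_sub (show (j : ℕ) + 1 ≤ r by omega)]
    ring
  have key := sum_sum_det (Matrix.of fun i j : Fin r => ∮ z in C(c, R), G i j z)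
  have hsum := iter_sum c R (Finset.univ : Finset (Equiv.Perm (Fin r) × Equiv.Perm (Fin r))) r
    (fun p => (((Equiv.Perm.sign p.1 : ℤ) : ℂ) * ((Equiv.Perm.sign p.2 : ℤ) : ℂ)))
    (fun p k => G (p.1 k) (p.2 k)) (fun p k => hG _ _)
  simp only [Matrix.of_apply] at key
  rw [key] at hsum
  have hI : (-1 : ℂ) ^ (r * (r + 1) / 2) * iterCircleIntegral c R r (fun z =>
          (∏ p ∈ Finset.univ.filter (fun p : Fin r × Fin r => p.1 < p.2), (z p.1 - z p.2) ^ 2) *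
            ∏ k : Fin r, (z k ^ (-(r : ℤ)) *
              (∏ ℓ ∈ Finset.Icc 1 n, a ℓ / (a ℓ - z k)) * Complex.exp (-(τ : ℂ) * z k))) =
      (-1) ^ r * ((r.factorial : ℂ) * (Matrix.of fun i j : Fin r => ∮ z in C(c, R), G i j z).det) := by
    rw [← hsum, iter_const_mul, iter_const_mul]
    congr 1
    funext z
    rw [← mul_assoc, vand_sq, mul_assoc, Finset.sum_mul]
    congr 1
    refine Finset.sum_congr rfl fun p _ => ?_
    rw [mul_assoc, ← Finset.prod_mul_distrib]
    congr 1
    refine Finset.prod_congr rfl fun k _ => ?_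
    simp only [G, hw]
    ring
  simp only [hint]
  have hdet : (Matrix.of fun i j : Fin r => -(1 / (2 * (Real.pi : ℂ) * Complex.I)) *
      ∮ z in C(c, R), G i j z) = (-(1 / (2 * (Real.pi : ℂ) * Complex.I))) •
      (Matrix.of fun i j : Fin r => ∮ z in C(c, R), G i j z) := by
    ext i j; simp
  rw [hdet, Matrix.det_smul, Fintype.card_fin, div_mul_eq_mul_div, hI]
  have hf : (r.factorial : ℂ) ≠ 0 := by exact_mod_cast r.factorial_ne_zero
  have hp : (2 * (Real.pi : ℂ) * Complex.I) ≠ 0 := Complex.two_pi_I_ne_zero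
  rw [neg_pow (1 / (2 * (Real.pi : ℂ) * Complex.I)), one_div, inv_pow]
  generalize (2 * (Real.pi : ℂ) * Complex.I) = q at hp
  field_simp
end

section
/- Let n ≥ r ≥ 1 be integers, τ ∈ ℝ, and 0 < ρ < 1. Let Γ be the positively oriented circle {z ∈ ℂ : |z − 1| = ρ}, and define A(s) = −(1/(2πi)) ∮_Γ z^{s−1} (1−z)^{−n} e^{−τ z} dz for s ∈ ℤ. Define G_{r,τ}(m) = Σ_{i=0}^{m−1} τ^i (r)_{m−i−1} / (i! · (m−i−1)!) for m ≥ 1 and G_{r,τ}(m) = 0 for m ≤ 0, where (r)_j = r(r+1)⋯(r+j−1) denotes the rising factorial with (r)_0 = 1. Then det[A(i−j)]_{i,j=1}^{r} = e^{−τ r} · det[G_{r,τ}(n+1−r+j−i)]_{i,j=1}^{r}. -/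
/-- `G_{r,τ}(m) = Σ_{i=0}^{m-1} τ^i (r)_{m-i-1} / (i! (m-i-1)!)` for `m ≥ 1`, and `0` for
`m ≤ 0`, where `(r)_j = r(r+1)⋯(r+j-1)` is the rising factorial. -/
noncomputable def Gcoef (r : ℕ) (τ : ℝ) (m : ℤ) : ℝ :=
  if m ≤ 0 then 0
  else ∑ i ∈ Finset.range m.toNat,
    τ ^ i * ((∏ j ∈ Finset.range (m.toNat - i - 1), (r + j) : ℕ) : ℝ) /
      ((i.factorial * (m.toNat - i - 1).factorial : ℕ) : ℝ)

lemma ne_zero_of_mem_closedBall_one {ρ : ℝ} (hρ1 : ρ < 1) {z : ℂ}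
    (hz : z ∈ Metric.closedBall (1 : ℂ) ρ) : z ≠ 0 := by
  rintro rfl
  simp [Metric.mem_closedBall] at hz
  linarith

lemma weight_differentiableAt (r : ℕ) (τ : ℝ) {z : ℂ} (hz : z ≠ 0) :
    DifferentiableAt ℂ (fun z : ℂ => z ^ (-(r : ℤ)) * Complex.exp (-(τ : ℂ) * z)) z := by
  apply DifferentiableAt.mul
  · exact differentiableAt_zpow.2 (Or.inl hz)
  · fun_prop

lemma weight_iteratedDeriv (r : ℕ) (τ : ℝ) (m : ℕ) :
    iteratedDeriv m (fun z : ℂ => z ^ (-(r : ℤ)) * Complex.exp (-(τ : ℂ) * z)) 1 =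
      (m.factorial : ℂ) * (-1) ^ m * Complex.exp (-(τ : ℂ)) * (Gcoef r τ ((m : ℤ) + 1) : ℂ) := by
  have h1 : ContDiffAt ℂ m (fun z : ℂ => Complex.exp (-(τ : ℂ) * z)) 1 := by fun_prop
  have h2 : ContDiffAt ℂ m (fun z : ℂ => z ^ (-(r : ℤ))) 1 := by
    have : (fun z : ℂ => z ^ (-(r : ℤ))) = fun z => (z ^ r)⁻¹ := by
      funext z; simp
    rw [this]
    exact ContDiffAt.inv (by fun_prop) (by simp)
  have hfun : (fun z : ℂ => z ^ (-(r : ℤ)) * Complex.exp (-(τ : ℂ) * z)) =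
      (fun z : ℂ => Complex.exp (-(τ : ℂ) * z)) * (fun z : ℂ => z ^ (-(r : ℤ))) := by
    funext z; simp [mul_comm]
  rw [hfun, iteratedDeriv_mul h1 h2]
  have ht : ((m : ℤ) + 1).toNat = m + 1 := by omega
  have hn : ¬ ((m : ℤ) + 1 ≤ 0) := by omega
  rw [Gcoef, if_neg hn, ht, Complex.ofReal_sum, Finset.mul_sum]
  refine Finset.sum_congr rfl fun i hi => ?_
  have him : i ≤ m := by have := Finset.mem_range.1 hi; omega
  rw [iteratedDeriv_cexp_const_mul, iteratedDeriv_eq_iterate, iter_deriv_zpow]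
  obtain ⟨k, rfl⟩ := Nat.exists_eq_add_of_le him
  have e1 : i + k - i = k := by omega
  have e2 : i + k + 1 - i - 1 = k := by omega
  rw [e1, e2]
  have hp : (∏ j ∈ Finset.range k, (((-(r : ℤ) : ℤ) : ℂ) - j)) =
      (-1) ^ k * ∏ j ∈ Finset.range k, ((r : ℂ) + j) := by
    rw [← Finset.card_range k, ← Finset.prod_const, Finset.card_range, ← Finset.prod_mul_distrib]
    refine Finset.prod_congr rfl fun j _ => ?_
    push_cast; ring
  rw [hp]
  have hc : ((i + k).choose i : ℂ) * (i.factorial : ℂ) * (k.factorial : ℂ)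
      = ((i + k).factorial : ℂ) := by
    have := Nat.add_choose_mul_factorial_mul_factorial i k
    rw [← Nat.choose_symm_add] at this
    exact_mod_cast this
  have hi0 : (i.factorial : ℂ) ≠ 0 := by exact_mod_cast i.factorial_ne_zero
  have hk0 : (k.factorial : ℂ) ≠ 0 := by exact_mod_cast k.factorial_ne_zero
  rw [← hc]
  push_cast
  rw [one_zpow, mul_one, mul_one, neg_pow (τ : ℂ) i, pow_add]
  field_simp

lemma cint_eq (r : ℕ) (τ ρ : ℝ) (hρ0 : 0 < ρ) (hρ1 : ρ < 1) (m : ℤ) :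
    -(1 / (2 * (Real.pi : ℂ) * Complex.I)) *
      (∮ z in C(1, ρ), (1 - z) ^ (-m) * (z ^ (-(r : ℤ)) * Complex.exp (-(τ : ℂ) * z))) =
    Complex.exp (-(τ : ℂ)) * (Gcoef r τ m : ℂ) := by
  have hd : ∀ z ∈ Metric.closedBall (1 : ℂ) ρ, DifferentiableAt ℂ
      (fun z : ℂ => z ^ (-(r : ℤ)) * Complex.exp (-(τ : ℂ) * z)) z := fun z hz =>
    weight_differentiableAt r τ (ne_zero_of_mem_closedBall_one hρ1 hz)
  by_cases hm : m ≤ 0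
  · obtain ⟨k, hk⟩ := Int.eq_ofNat_of_zero_le (show 0 ≤ -m by omega)
    have hd' : ∀ z ∈ Metric.closedBall (1 : ℂ) ρ, DifferentiableAt ℂ
      (fun z : ℂ => (1 - z) ^ k * (z ^ (-(r : ℤ)) * Complex.exp (-(τ : ℂ) * z))) z :=
      fun z hz => DifferentiableAt.mul (by fun_prop) (hd z hz)
    rw [hk, Gcoef, if_pos hm]
    simp only [zpow_natCast]
    rw [Complex.circleIntegral_eq_zero_of_differentiable_on_off_countable hρ0.le
      Set.countable_empty (fun z hz => (hd' z hz).continuousAt.continuousWithinAt)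
      (fun z hz => hd' z (Metric.ball_subset_closedBall hz.1))]
    simp
  · obtain ⟨k, hk⟩ := Int.eq_ofNat_of_zero_le (show 0 ≤ m - 1 by omega)
    obtain rfl : m = (k : ℤ) + 1 := by omega
    have := Complex.circleIntegral_one_div_sub_center_pow_smul_of_differentiable_on_off_countable
      hρ0 k Set.countable_empty (fun z hz => (hd z hz).continuousAt.continuousWithinAt)
      (fun z hz => hd z (Metric.ball_subset_closedBall hz.1))
    rw [weight_iteratedDeriv] at this
    have hcongr : (fun z : ℂ => (1 - z) ^ (-((k : ℤ) + 1)) *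
        (z ^ (-(r : ℤ)) * Complex.exp (-(τ : ℂ) * z))) = fun z =>
        (-1) ^ (k + 1) * ((1 / (z - 1) ^ (k + 1)) •
          (z ^ (-(r : ℤ)) * Complex.exp (-(τ : ℂ) * z))) := by
      funext z
      have : (1 - z) ^ (-((k : ℤ) + 1)) = (-1) ^ (k + 1) * (1 / (z - 1) ^ (k + 1)) := by
        rw [show -((k : ℤ) + 1) = -((k + 1 : ℕ) : ℤ) by push_cast; ring, zpow_neg, zpow_natCast,
          show 1 - z = (-1) * (z - 1) by ring, mul_pow, mul_inv, one_div, ← inv_pow (-1 : ℂ)]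
        norm_num
      rw [this, smul_eq_mul, mul_assoc]
    rw [hcongr, circleIntegral.integral_const_mul, this, smul_eq_mul]
    have hk0 : (k.factorial : ℂ) ≠ 0 := by exact_mod_cast k.factorial_ne_zero
    have hpi : (Real.pi : ℂ) ≠ 0 := by exact_mod_cast Real.pi_ne_zero
    have hs : ((-1 : ℂ) ^ k) * (-1) ^ k = 1 := by rw [← mul_pow]; norm_num
    have hI := Complex.I_ne_zero
    rw [pow_succ]
    field_simp
    linear_combination (Gcoef r τ ((k : ℤ) + 1) : ℂ) * hs

noncomputable def binMat (r : ℕ) : Matrix (Fin r) (Fin r) ℂ :=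
  Matrix.of fun i k => (-1) ^ (k : ℕ) * ((i : ℕ).choose k : ℂ)

lemma binMat_det_sq (r : ℕ) : (binMat r).det * (binMat r).det = 1 := by
  have : (binMat r).det = ∏ i : Fin r, (-1 : ℂ) ^ (i : ℕ) := by
    rw [Matrix.det_of_isLowerTriangular]
    · simp [binMat]
    · intro i j hij
      have : (i : ℕ) < j := hij
      simp [binMat, Nat.choose_eq_zero_of_lt this]
  rw [this, ← Finset.prod_mul_distrib]
  refine Finset.prod_eq_one fun i _ => ?_
  rw [← mul_pow]; norm_num

lemma pow_eq_binMat (r : ℕ) (i : Fin r) (z : ℂ) :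
    z ^ (i : ℕ) = ∑ k : Fin r, binMat r i k * (1 - z) ^ (k : ℕ) := by
  have h : z ^ (i : ℕ) = (-(1 - z) + 1) ^ (i : ℕ) := by congr 1; ring
  rw [h, add_pow]
  simp only [binMat, Matrix.of_apply]
  rw [Fin.sum_univ_eq_sum_range
    (fun k => (-1 : ℂ) ^ k * ((i : ℕ).choose k : ℂ) * (1 - z) ^ k) r]
  have hsub : Finset.range ((i : ℕ) + 1) ⊆ Finset.range r := by
    intro x hx; simp at hx ⊢; omega
  rw [← Finset.sum_subset hsub]
  · refine Finset.sum_congr rfl fun k _ => ?_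
    rw [neg_pow]; ring
  · intro x _ hx
    have : (i : ℕ) < x := by simp at hx; omega
    simp [Nat.choose_eq_zero_of_lt this]

/-- Corollary 3.5, Plancherel case, via Lemma 3.4: the Toeplitz determinant
with symbol coefficients `A(s) = -(1/(2πi)) ∮_Γ z^{s-1} (1-z)^{-n} e^{-τz} dz` (with `Γ` the
circle of radius `ρ` around `1`) equals `e^{-τr} det[G_{r,τ}(n+1-r+j-i)]_{i,j=1}^r`. -/
theorem toeplitzDet_eq_exp_mul_detG (n r : ℕ) (hr : 1 ≤ r) (hrn : r ≤ n) (τ : ℝ)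
    (ρ : ℝ) (hρ0 : 0 < ρ) (hρ1 : ρ < 1) :
    (Matrix.of fun i j : Fin r =>
        -(1 / (2 * (Real.pi : ℂ) * Complex.I)) *
          ∮ z in C(1, ρ), z ^ (((i : ℤ) - (j : ℤ)) - 1) * (1 - z) ^ (-(n : ℤ)) *
            Complex.exp (-(τ : ℂ) * z)).det =
      (Real.exp (-τ * r) : ℂ) *
        (Matrix.of fun i j : Fin r =>
          (Gcoef r τ ((n : ℤ) + 1 - (r : ℤ) + (j : ℤ) - (i : ℤ)) : ℂ)).det := by
  classical
  set C : Matrix (Fin r) (Fin r) ℂ := Matrix.of fun i j : Fin r =>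
    (Gcoef r τ ((n : ℤ) + 1 - (r : ℤ) + (j : ℤ) - (i : ℤ)) : ℂ) with hC
  set Q : Matrix (Fin r) (Fin r) ℂ := ((binMat r).submatrix Fin.revPerm Fin.revPerm).transpose
    with hQ
  have key : (Matrix.of fun i j : Fin r =>
        -(1 / (2 * (Real.pi : ℂ) * Complex.I)) *
          ∮ z in C(1, ρ), z ^ (((i : ℤ) - (j : ℤ)) - 1) * (1 - z) ^ (-(n : ℤ)) *
            Complex.exp (-(τ : ℂ) * z)) = Complex.exp (-(τ : ℂ)) • (binMat r * C * Q) := by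
    ext i j
    have hpt : Set.EqOn (fun z : ℂ => z ^ (((i : ℤ) - (j : ℤ)) - 1) * (1 - z) ^ (-(n : ℤ)) *
            Complex.exp (-(τ : ℂ) * z))
        (fun z => ∑ l : Fin r, ∑ k : Fin r, (binMat r i k * Q l j) *
          ((1 - z) ^ (-((n : ℤ) + 1 - (r : ℤ) + (l : ℤ) - (k : ℤ))) *
            (z ^ (-(r : ℤ)) * Complex.exp (-(τ : ℂ) * z)))) (Metric.sphere 1 ρ) := by
      intro z hz
      have hz0 : z ≠ 0 := ne_zero_of_mem_closedBall_one hρ1 (Metric.sphere_subset_closedBall hz)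
      have hz1 : 1 - z ≠ 0 := by
        intro h
        have : z = 1 := by linear_combination -h
        subst this
        simp at hz
        linarith
      have hj : z ^ ((Fin.rev j : Fin r) : ℕ) =
          ∑ l : Fin r, Q l j * (1 - z) ^ ((Fin.rev l : Fin r) : ℕ) := by
        rw [pow_eq_binMat, ← Equiv.sum_comp Fin.revPerm]
        rfl
      have hz2 : z ^ (((i : ℤ) - (j : ℤ)) - 1) =
          z ^ (i : ℕ) * z ^ ((Fin.rev j : Fin r) : ℕ) * z ^ (-(r : ℤ)) := by
        rw [← zpow_natCast, ← zpow_natCast, ← zpow_add₀ hz0, ← zpow_add₀ hz0]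
        congr 1
        rw [Fin.val_rev]
        have := j.2
        omega
      simp only []
      rw [hz2, hj, pow_eq_binMat r i, Finset.sum_mul_sum, Finset.sum_comm, Finset.sum_mul,
        Finset.sum_mul, Finset.sum_mul]
      refine Finset.sum_congr rfl fun l _ => ?_
      rw [Finset.sum_mul, Finset.sum_mul, Finset.sum_mul]
      refine Finset.sum_congr rfl fun k _ => ?_
      have : (1 - z) ^ (-((n : ℤ) + 1 - (r : ℤ) + (l : ℤ) - (k : ℤ))) =
          (1 - z) ^ (k : ℕ) * (1 - z) ^ ((Fin.rev l : Fin r) : ℕ) * (1 - z) ^ (-(n : ℤ)) := by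
        rw [← zpow_natCast, ← zpow_natCast, ← zpow_add₀ hz1, ← zpow_add₀ hz1]
        congr 1
        rw [Fin.val_rev]
        have := l.2
        omega
      rw [this]
      ring
    have hint : ∀ (m : ℤ), CircleIntegrable (fun z : ℂ => (1 - z) ^ (-m) *
            (z ^ (-(r : ℤ)) * Complex.exp (-(τ : ℂ) * z))) 1 ρ := by
      intro m
      apply ContinuousOn.circleIntegrable hρ0.le
      intro z hz
      have hz0 : z ≠ 0 := ne_zero_of_mem_closedBall_one hρ1 (Metric.sphere_subset_closedBall hz)
      have hz1 : 1 - z ≠ 0 := by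
        intro h
        have : z = 1 := by linear_combination -h
        subst this
        simp at hz
        linarith
      apply ContinuousAt.continuousWithinAt
      apply ContinuousAt.mul
      · exact ContinuousAt.zpow₀ (by fun_prop) _ (Or.inl hz1)
      · exact (weight_differentiableAt r τ hz0).continuousAt
    have hint2 : ∀ (a : ℂ) (m : ℤ), CircleIntegrable (fun z : ℂ => a * ((1 - z) ^ (-m) *
            (z ^ (-(r : ℤ)) * Complex.exp (-(τ : ℂ) * z)))) 1 ρ := by
      intro a m
      exact (hint m).const_smul (a := a)
    rw [Matrix.of_apply, circleIntegral.integral_congr hρ0.le hpt, circleIntegral.integral_fun_sum]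
    · rw [Matrix.smul_apply, Matrix.mul_apply, smul_eq_mul, Finset.mul_sum, Finset.mul_sum]
      refine Finset.sum_congr rfl fun l _ => ?_
      rw [circleIntegral.integral_fun_sum (fun k _ => hint2 _ _), Matrix.mul_apply,
        Finset.mul_sum, Finset.sum_mul, Finset.mul_sum]
      refine Finset.sum_congr rfl fun k _ => ?_
      rw [circleIntegral.integral_const_mul]
      have := cint_eq r τ ρ hρ0 hρ1 ((n : ℤ) + 1 - (r : ℤ) + (l : ℤ) - (k : ℤ))
      rw [hC, Matrix.of_apply]
      linear_combination (binMat r i k * Q l j) * this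
    · intro l _
      exact CircleIntegrable.fun_sum _ (fun k _ => hint2 _ _)
  rw [key, Matrix.det_smul, Matrix.det_mul, Matrix.det_mul, hQ, Matrix.det_transpose,
    Matrix.det_submatrix_equiv_self, Fintype.card_fin, ← Complex.exp_nat_mul]
  have he : Complex.exp ((r : ℂ) * -(τ : ℂ)) = (Real.exp (-τ * r) : ℂ) := by
    push_cast; congr 1; ring
  rw [he]
  linear_combination ((Real.exp (-τ * r) : ℂ) * C.det) * binMat_det_sq r
end

section
/- Let n ≥ r ≥ 1 be integers. For m ∈ ℤ define the real polynomial P_m ∈ ℝ[τ] by P_m = Σ_{i=0}^{m−1} ((r)_{m−1−i} / (i! · (m−1−i)!)) τ^i for m ≥ 1 and P_m = 0 for m ≤ 0, where (r)_j = r(r+1)⋯(r+j−1) is the rising factorial with (r)_0 = 1. Then every coefficient of the determinant det[P_{n+1−r+j−i}]_{i,j=1}^{r}, computed in the polynomial ring ℝ[τ], is nonnegative. -/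
/-- The real polynomial `P_m = Σ_{i=0}^{m-1} ((r)_{m-1-i} / (i! (m-1-i)!)) τ^i` for `m ≥ 1`,
and `P_m = 0` for `m ≤ 0`, where `(r)_j = r(r+1)⋯(r+j-1)` is the rising factorial. -/
noncomputable def Ppoly (r : ℕ) (m : ℤ) : Polynomial ℝ :=
  if m ≤ 0 then 0
  else ∑ i ∈ Finset.range m.toNat,
    Polynomial.C (((∏ j ∈ Finset.range (m.toNat - 1 - i), (r + j) : ℕ) : ℝ) /
      ((i.factorial * (m.toNat - 1 - i).factorial : ℕ) : ℝ)) * Polynomial.X ^ i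

/-- Coefficients of `Ppoly`. -/
lemma aux_coeff (r : ℕ) (m : ℤ) (k : ℕ) : (Ppoly r m).coeff k =
    if (k : ℤ) < m then ((∏ j ∈ Finset.range (m.toNat - 1 - k), (r + j) : ℕ) : ℝ) /
      ((k.factorial * (m.toNat - 1 - k).factorial : ℕ) : ℝ) else 0 := by
  unfold Ppoly
  by_cases hm : m ≤ 0
  · rw [if_pos hm, if_neg (by omega)]; simp
  · rw [if_neg hm, Polynomial.finsetSum_coeff]
    simp only [Polynomial.coeff_C_mul_X_pow]
    rw [Finset.sum_ite_eq]
    have : k ∈ Finset.range m.toNat ↔ (k : ℤ) < m := by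
      rw [Finset.mem_range]; omega
    simp only [this]

lemma aux_deriv (r : ℕ) (m : ℤ) :
    Polynomial.derivative (Ppoly r m) = Ppoly r (m - 1) := by
  ext k
  rw [Polynomial.coeff_derivative, aux_coeff, aux_coeff]
  by_cases h : ((k + 1 : ℕ) : ℤ) < m
  · rw [if_pos h, if_pos (by push_cast at h; omega)]
    have e : (m - 1).toNat - 1 - k = m.toNat - 1 - (k + 1) := by omega
    rw [e, Nat.factorial_succ]
    generalize (∏ j ∈ Finset.range (m.toNat - 1 - (k + 1)), (r + j) : ℕ) = A
    have h1 := Nat.factorial_pos k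
    have h2 := Nat.factorial_pos (m.toNat - 1 - (k + 1))
    push_cast
    field_simp
  · rw [if_neg h, if_neg (by push_cast at h; omega)]; simp

/-- The determinant with general row shifts. -/
noncomputable def auxM (r : ℕ) (a : Fin r → ℤ) : Matrix (Fin r) (Fin r) (Polynomial ℝ) :=
  Matrix.of fun i j : Fin r => Ppoly r (a i + (j : ℤ))

lemma aux_det_deriv (r : ℕ) (a : Fin r → ℤ) :
    Polynomial.derivative (auxM r a).det =
      ∑ i, (auxM r (Function.update a i (a i - 1))).det := by
  rw [← Matrix.det_transpose]
  simp_rw [← Matrix.det_transpose (auxM r (Function.update a _ _)), Matrix.det_apply]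
  rw [Finset.sum_comm, Polynomial.derivative_sum]
  refine Finset.sum_congr rfl fun σ _ => ?_
  rw [← Finset.smul_sum]
  have : ∀ (u : ℤˣ) (p : Polynomial ℝ),
      Polynomial.derivative (u • p) = u • Polynomial.derivative p := by
    intro u p
    rw [Units.smul_def, Units.smul_def, map_zsmul]
  rw [this, Polynomial.derivative_prod_finset]
  congr 1
  refine Finset.sum_congr rfl fun i _ => ?_
  rw [← Finset.mul_prod_erase Finset.univ _ (Finset.mem_univ i), mul_comm]
  simp only [auxM, Matrix.transpose_apply, Matrix.of_apply, Function.update_self, aux_deriv]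
  congr 1
  · congr 1; ring
  · refine Finset.prod_congr rfl fun j hj => ?_
    rw [Function.update_of_ne (Finset.ne_of_mem_erase hj)]

/-- The polynomial interpolating the constant terms. -/
lemma aux_const (r : ℕ) (hr : 1 ≤ r) (m : ℤ) (hm : 2 - (r : ℤ) ≤ m) :
    (Ppoly r m).coeff 0 =
      (ascPochhammer ℝ (r - 1)).eval (m : ℝ) / ((r - 1).factorial : ℝ) := by
  obtain ⟨s, rfl⟩ : ∃ s, r = s + 1 := ⟨r - 1, by omega⟩
  rw [aux_coeff]
  simp only [Nat.add_sub_cancel, Nat.sub_zero, Nat.factorial_zero, one_mul]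
  split_ifs with h
  · obtain ⟨k, rfl⟩ : ∃ k : ℕ, m = k + 1 := ⟨(m - 1).toNat, by push_cast at h; omega⟩
    have e : ((k : ℤ) + 1).toNat - 1 = k := by omega
    rw [e, ← Nat.ascFactorial_eq_prod_range]
    have h1 : (((k : ℤ) + 1 : ℤ) : ℝ) = ((k + 1 : ℕ) : ℝ) := by push_cast; rfl
    rw [h1, ← ascPochhammer_eval_cast, ascPochhammer_nat_eq_ascFactorial]
    have h2 := Nat.factorial_mul_ascFactorial s k
    have h3 := Nat.factorial_mul_ascFactorial k s
    have h4 := Nat.factorial_pos k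
    have h5 := Nat.factorial_pos s
    rw [div_eq_div_iff (by positivity) (by positivity)]
    norm_cast
    rw [mul_comm, h2, mul_comm, h3, add_comm]
  · push_cast at h hm
    obtain ⟨k, rfl⟩ : ∃ k : ℕ, m = -k := ⟨(-m).toNat, by omega⟩
    have : (ascPochhammer ℝ s).eval (((-k : ℤ)) : ℝ) = 0 := by
      push_cast
      exact ascPochhammer_eval_neg_coe_nat_of_lt (by omega)
    rw [this, zero_div]

lemma aux_vand_sign (r : ℕ) (a b : Fin r → ℝ) (ha : StrictAnti a) (hb : StrictAnti b) :
    0 < (Matrix.vandermonde a).det * (Matrix.vandermonde b).det := by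
  rw [Matrix.det_vandermonde, Matrix.det_vandermonde, ← Finset.prod_mul_distrib]
  refine Finset.prod_pos fun i _ => ?_
  rw [← Finset.prod_mul_distrib]
  refine Finset.prod_pos fun j hj => ?_
  have hij : i < j := by simpa using hj
  have h1 := ha hij
  have h2 := hb hij
  exact mul_pos_of_neg_of_neg (by linarith) (by linarith)

lemma aux_factor (r : ℕ) (hr : 1 ≤ r) : ∃ C : Matrix (Fin r) (Fin r) ℝ,
    ∀ a : Fin r → ℤ, (∀ i, 2 - (r : ℤ) ≤ a i) →
      (auxM r a).det.coeff 0 = (Matrix.vandermonde fun i => (a i : ℝ)).det * C.det := by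
  let q : Fin r → Polynomial ℝ := fun j =>
    (ascPochhammer ℝ (r - 1)).comp (Polynomial.X + Polynomial.C ((j : ℕ) : ℝ))
  refine ⟨Matrix.of fun k j => (q j).coeff k / ((r - 1).factorial : ℝ), fun a ha => ?_⟩
  rw [← Matrix.det_mul, ← Polynomial.constantCoeff_apply, RingHom.map_det]
  congr 1
  ext i j
  rw [RingHom.mapMatrix_apply, Matrix.map_apply, Polynomial.constantCoeff_apply, Matrix.mul_apply]
  have := ha i
  simp only [auxM, Matrix.of_apply, Matrix.vandermonde_apply]
  rw [aux_const r hr _ (by omega)]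
  have hq : (q j).natDegree < r := by
    refine lt_of_le_of_lt Polynomial.natDegree_comp_le ?_
    rw [Polynomial.natDegree_X_add_C, ascPochhammer_natDegree]; omega
  have e : (ascPochhammer ℝ (r - 1)).eval ((a i + (j : ℤ) : ℤ) : ℝ) = (q j).eval (a i : ℝ) := by
    simp [q]
  rw [e, Polynomial.eval_eq_sum_range' hq, Finset.sum_range, Finset.sum_div]
  refine Finset.sum_congr rfl fun k _ => ?_
  ring

lemma aux_ref (r : ℕ) : (auxM r fun i => 1 - (i : ℤ)).det.coeff 0 = 1 := by
  rw [← Polynomial.constantCoeff_apply, RingHom.map_det, Matrix.det_of_isUpperTriangular]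
  · refine Finset.prod_eq_one fun i _ => ?_
    simp [auxM, aux_coeff]
  · intro i j hij
    replace hij : (j : ℕ) < i := hij
    simp only [RingHom.mapMatrix_apply, Matrix.map_apply, Polynomial.constantCoeff_apply, auxM,
      Matrix.of_apply, aux_coeff]
    rw [if_neg (by push_cast; omega)]

lemma aux_base (r : ℕ) (hr : 1 ≤ r) (a : Fin r → ℤ) (ha : StrictAnti a) :
    0 ≤ (auxM r a).det.coeff 0 := by
  by_cases h : ∀ i, 2 - (r : ℤ) ≤ a i
  · obtain ⟨C, hC⟩ := aux_factor r hr
    have h1 := hC _ h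
    have h2 := hC (fun i => 1 - (i : ℤ)) (fun i => by have := i.2; omega)
    rw [aux_ref] at h2
    have h3 := aux_vand_sign r (fun i => (a i : ℝ)) (fun i => ((1 - (i : ℤ) : ℤ) : ℝ))
      (fun i j hij => by
        have h := ha hij
        show (a j : ℝ) < (a i : ℝ)
        exact_mod_cast h)
      (fun i j hij => by
        have : (i : ℕ) < j := hij
        have h : (1 - (j : ℤ)) < 1 - (i : ℤ) := by omega
        exact Int.cast_lt.mpr h)
    rw [h1]
    set V := (Matrix.vandermonde fun i => (a i : ℝ)).det
    set W := (Matrix.vandermonde fun i : Fin r => ((1 - (i : ℤ) : ℤ) : ℝ)).det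
    have : V * C.det = (V * W) * C.det ^ 2 := by
      calc V * C.det = V * C.det * 1 := by ring
        _ = V * C.det * (W * C.det) := by rw [← h2]
        _ = _ := by ring
    rw [this]
    positivity
  · push Not at h
    obtain ⟨i, hi⟩ := h
    rw [← Polynomial.constantCoeff_apply, RingHom.map_det, Matrix.det_eq_zero_of_row_eq_zero i]
    intro j
    simp only [RingHom.mapMatrix_apply, Matrix.map_apply, Polynomial.constantCoeff_apply, auxM,
      Matrix.of_apply, aux_coeff]
    rw [if_neg]
    have := j.2
    push_cast
    omega

lemma aux_main (r : ℕ) (hr : 1 ≤ r) (m : ℕ) : ∀ a : Fin r → ℤ, StrictAnti a →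
    0 ≤ (auxM r a).det.coeff m := by
  induction m with
  | zero => exact aux_base r hr
  | succ m ih =>
    intro a ha
    have h1 : 0 ≤ (Polynomial.derivative (auxM r a).det).coeff m := by
      rw [aux_det_deriv, Polynomial.finsetSum_coeff]
      refine Finset.sum_nonneg fun i _ => ?_
      by_cases hs : ∃ j, j ≠ i ∧ a j = a i - 1
      · obtain ⟨j, hji, hj⟩ := hs
        rw [Matrix.det_zero_of_row_eq hji]
        · simp
        · ext1 k
          simp [auxM, Function.update_of_ne hji, hj]
      · push Not at hs
        apply ih
        intro j k hjk
        have h := ha hjk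
        have hk := hs k
        by_cases e1 : j = i
        · subst e1
          have := hk hjk.ne'
          rw [Function.update_self, Function.update_of_ne hjk.ne']
          omega
        · rw [Function.update_of_ne e1]
          by_cases e2 : k = i
          · subst e2; rw [Function.update_self]; omega
          · rw [Function.update_of_ne e2]; exact h
    rw [Polynomial.coeff_derivative] at h1
    exact nonneg_of_mul_nonneg_left h1 (by positivity)

/-- positivity in the determinantal expression, Appendix B of the paper:
every coefficient of the polynomial `det[P_{n+1-r+j-i}]_{i,j=1}^r ∈ ℝ[τ]` is nonnegative. -/
theorem detPpoly_coeff_nonneg (n r : ℕ) (hr : 1 ≤ r) (hrn : r ≤ n) :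
    ∀ m : ℕ,
      0 ≤ ((Matrix.of fun i j : Fin r =>
        Ppoly r ((n : ℤ) + 1 - (r : ℤ) + (j : ℤ) - (i : ℤ))).det).coeff m := by
  intro m
  have h := aux_main r hr m (fun i => (n : ℤ) + 1 - r - i) (fun i j hij => by
    have : (i : ℕ) < j := hij
    show (n : ℤ) + 1 - r - (j : ℕ) < (n : ℤ) + 1 - r - (i : ℕ)
    omega)
  convert h using 3
  ext1 i j
  simp only [auxM, Matrix.of_apply]
  congr 1
  ring
end

section
/- Let n ≥ r ≥ 1 be integers. Then the r×r Toeplitz determinant det[1/(n−r+j−i)!]_{i,j=1}^{r}, where by convention 1/m! = 0 whenever m < 0, equals ∏_{k=0}^{r−1} (r−1−k)! / (n−r+k)!. -/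
/-- Toeplitz determinant evaluation `M(n,r)` in the proof of
Proposition 5.5: `det[1/(n-r+j-i)!]_{i,j=1}^r = ∏_{k=0}^{r-1} (r-1-k)!/(n-r+k)!`, with the
convention `1/m! = 0` for `m < 0`. -/
theorem toeplitz_factorial_det (n r : ℕ) (hr : 1 ≤ r) (hrn : r ≤ n) :
    (Matrix.of fun i j : Fin r =>
        (fun m : ℤ => if m < 0 then (0 : ℚ) else 1 / (m.toNat.factorial : ℚ))
          ((n : ℤ) - (r : ℤ) + (j : ℤ) - (i : ℤ))).det =
      ∏ k ∈ Finset.range r, ((r - 1 - k).factorial : ℚ) / ((n - r + k).factorial : ℚ) := by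
  obtain ⟨d, rfl⟩ := Nat.exists_eq_add_of_le hrn
  obtain ⟨s, rfl⟩ := Nat.exists_eq_add_of_le' hr
  have hd : s + 1 + d - (s + 1) = d := by omega
  rw [hd]
  have hA : (Matrix.of fun i j : Fin (s + 1) =>
        (fun m : ℤ => if m < 0 then (0 : ℚ) else 1 / (m.toNat.factorial : ℚ))
          (((s + 1 + d : ℕ) : ℤ) - ((s + 1 : ℕ) : ℤ) + (j : ℤ) - (i : ℤ))) =
      Matrix.of fun i j : Fin (s + 1) => (1 / ((d + (j : ℕ)).factorial : ℚ)) *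
        (Matrix.of fun j i : Fin (s + 1) =>
          ((descPochhammer ℚ (i : ℕ)).eval ((j : ℚ) + (d : ℚ)))).transpose i j := by
    ext i j
    simp only [Matrix.of_apply, Matrix.transpose_apply]
    have h1 : ((j : ℕ) : ℚ) + (d : ℚ) = ((d + (j : ℕ) : ℕ) : ℚ) := by push_cast; ring
    rw [h1, descPochhammer_eval_eq_descFactorial]
    split_ifs with h
    · rw [Nat.descFactorial_eq_zero_iff_lt.mpr (by omega)]; simp
    · have hle : (i : ℕ) ≤ d + (j : ℕ) := by omega
      have h2 : (((s + 1 + d : ℕ) : ℤ) - ((s + 1 : ℕ) : ℤ) + (j : ℤ) - (i : ℤ)).toNat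
          = d + (j : ℕ) - (i : ℕ) := by omega
      rw [h2, ← Nat.factorial_mul_descFactorial hle]
      have h3 : ((d + (j : ℕ) - (i : ℕ)).factorial : ℚ) ≠ 0 := by
        exact_mod_cast Nat.factorial_ne_zero _
      have h4 : ((d + (j : ℕ)).descFactorial (i : ℕ) : ℚ) ≠ 0 := by
        rw [Nat.cast_ne_zero, Ne, Nat.descFactorial_eq_zero_iff_lt]; omega
      push_cast
      field_simp
  rw [hA, Matrix.det_mul_row, Matrix.det_transpose]
  have hV := Matrix.det_eval_matrixOfPolynomials_eq_det_vandermonde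
    (fun j : Fin (s + 1) => (j : ℚ) + (d : ℚ)) (fun i => descPochhammer ℚ (i : ℕ))
    (fun i => descPochhammer_natDegree ℚ i) (fun i => monic_descPochhammer ℚ i)
  rw [← hV, Matrix.det_vandermonde_add, Matrix.det_vandermonde_id_eq_superFactorial,
    ← Nat.prod_range_succ_factorial, Finset.prod_div_distrib, Finset.prod_div_distrib,
    Fin.prod_univ_eq_prod_range (fun k => ((d + k).factorial : ℚ)),
    ← Finset.prod_range_reflect (fun k => Nat.factorial k)]
  push_cast
  simp [div_eq_mul_inv, mul_comm]
end

section
/- Let n ≥ r ≥ 1 be integers and let τ be a nonzero real number. Then det[τ^{n−r+j−i}/(n−r+j−i)!]_{i,j=1}^{r} / det[τ^{n−r+1+j−i}/(n−r+1+j−i)!]_{i,j=1}^{r−1} = τ^{n+1−2r} · (r−1)! / (n−r)!, where an entry τ^{m}/m! is taken to be 0 whenever m < 0, and the determinant of a 0×0 matrix is 1. -/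
/-- Closed form for the Toeplitz determinant. -/
lemma toeplitz_det_aux (a k : ℕ) (τ : ℝ) (hτ : τ ≠ 0) :
    (Matrix.of fun i j : Fin k =>
        (fun m : ℤ => if m < 0 then (0 : ℝ) else τ ^ m.toNat / (m.toNat.factorial : ℝ))
          ((a : ℤ) + (j : ℤ) - (i : ℤ))).det =
      ∏ j ∈ Finset.range k, (τ ^ a * ((j.factorial : ℝ) / ((a + j).factorial : ℝ))) := by
  have hE : (Matrix.of fun i j : Fin k =>
        (fun m : ℤ => if m < 0 then (0 : ℝ) else τ ^ m.toNat / (m.toNat.factorial : ℝ))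
          ((a : ℤ) + (j : ℤ) - (i : ℤ))) =
      Matrix.of fun i j : Fin k => (τ⁻¹ ^ (i : ℕ)) *
        (Matrix.of fun i j : Fin k => (τ ^ (a + (j : ℕ)) / ((a + (j : ℕ)).factorial : ℝ)) *
          (Matrix.of fun j i : Fin k =>
            (descPochhammer ℝ (i : ℕ)).eval (((j : ℕ) : ℝ) + (a : ℝ))).transpose i j) i j := by
    ext i j
    simp only [Matrix.of_apply, Matrix.transpose_apply]
    have hc : ((j : ℕ) : ℝ) + (a : ℝ) = ((a + (j : ℕ) : ℕ) : ℝ) := by push_cast; ring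
    rw [hc, descPochhammer_eval_eq_descFactorial]
    split_ifs with h
    · have : (a + (j : ℕ)) < (i : ℕ) := by omega
      rw [Nat.descFactorial_eq_zero_iff_lt.mpr this]
      simp
    · have hle : (i : ℕ) ≤ a + (j : ℕ) := by omega
      have h1 : ((a : ℤ) + (j : ℤ) - (i : ℤ)).toNat = a + (j : ℕ) - (i : ℕ) := by omega
      rw [h1]
      obtain ⟨d, hd⟩ := Nat.exists_eq_add_of_le hle
      have h2 := Nat.factorial_mul_descFactorial hle
      rw [hd] at h2 ⊢
      rw [Nat.add_sub_cancel_left] at h2 ⊢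
      rw [← h2, pow_add, inv_pow]
      have h3 : (d.factorial : ℝ) ≠ 0 := by positivity
      have h4 : (((i : ℕ) + d).descFactorial (i : ℕ) : ℝ) ≠ 0 := by
        rw [Nat.cast_ne_zero, Ne, Nat.descFactorial_eq_zero_iff_lt]; omega
      push_cast
      field_simp
  have hV : (Matrix.of fun j i : Fin k =>
      (descPochhammer ℝ (i : ℕ)).eval (((j : ℕ) : ℝ) + (a : ℝ))).det =
      ∏ j ∈ Finset.range k, (j.factorial : ℝ) := by
    rw [← Matrix.det_eval_matrixOfPolynomials_eq_det_vandermonde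
      (fun j : Fin k => ((j : ℕ) : ℝ) + (a : ℝ)) (fun i : Fin k => descPochhammer ℝ (i : ℕ))
      (fun i => descPochhammer_natDegree ℝ i) (fun i => monic_descPochhammer ℝ i),
      Matrix.det_vandermonde_add]
    cases k with
    | zero => simp
    | succ k =>
      rw [Matrix.det_vandermonde_id_eq_superFactorial, ← Nat.prod_range_succ_factorial]
      push_cast
      rfl
  rw [hE, Matrix.det_mul_column, Matrix.det_mul_row, Matrix.det_transpose, hV,
    Fin.prod_univ_eq_prod_range (fun i => τ⁻¹ ^ i) k,
    Fin.prod_univ_eq_prod_range (fun j => τ ^ (a + j) / ((a + j).factorial : ℝ)) k,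
    ← Finset.prod_mul_distrib, ← Finset.prod_mul_distrib]
  refine Finset.prod_congr rfl fun j _ => ?_
  rw [pow_add, inv_pow]
  field_simp

/-- identity (5.18) in the proof of Proposition 5.5: the ratio of the two
Toeplitz determinants with entries `τ^m/m!` (entries `0` for `m < 0`, `0 × 0` determinant `= 1`)
equals `τ^{n+1-2r} (r-1)!/(n-r)!`. -/
theorem toeplitz_ratio_eval (n r : ℕ) (hr : 1 ≤ r) (hrn : r ≤ n) (τ : ℝ) (hτ : τ ≠ 0) :
    (Matrix.of fun i j : Fin r =>
        (fun m : ℤ => if m < 0 then (0 : ℝ) else τ ^ m.toNat / (m.toNat.factorial : ℝ))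
          ((n : ℤ) - (r : ℤ) + (j : ℤ) - (i : ℤ))).det /
      (Matrix.of fun i j : Fin (r - 1) =>
        (fun m : ℤ => if m < 0 then (0 : ℝ) else τ ^ m.toNat / (m.toNat.factorial : ℝ))
          ((n : ℤ) - (r : ℤ) + 1 + (j : ℤ) - (i : ℤ))).det =
      τ ^ ((n : ℤ) + 1 - 2 * (r : ℤ)) * ((r - 1).factorial : ℝ) / ((n - r).factorial : ℝ) := by
  obtain ⟨s, rfl⟩ : ∃ s, r = s + 1 := ⟨r - 1, by omega⟩
  obtain ⟨a, rfl⟩ : ∃ a, n = s + 1 + a := Nat.exists_eq_add_of_le hrn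
  have e1 : (((s + 1 + a : ℕ) : ℤ) - ((s + 1 : ℕ) : ℤ)) = (a : ℤ) := by push_cast; ring
  have e2 : (a : ℤ) + 1 = ((a + 1 : ℕ) : ℤ) := by push_cast; ring
  have e3 : ((s + 1 + a : ℕ) : ℤ) + 1 - 2 * ((s + 1 : ℕ) : ℤ) = (a : ℤ) - (s : ℤ) := by
    push_cast; ring
  rw [e1, e2, e3, toeplitz_det_aux a (s + 1) τ hτ, toeplitz_det_aux (a + 1) (s + 1 - 1) τ hτ]
  simp only [Nat.add_sub_cancel, Nat.add_sub_cancel_left]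
  rw [zpow_sub₀ hτ, zpow_natCast, zpow_natCast]
  clear e1 e2 e3 hr hrn
  have hne : ∀ b k : ℕ,
      ∏ j ∈ Finset.range k, (τ ^ b * ((j.factorial : ℝ) / ((b + j).factorial : ℝ))) ≠ 0 := by
    intro b k
    refine Finset.prod_ne_zero_iff.mpr fun j _ => ?_
    have := Nat.factorial_ne_zero j
    have := Nat.factorial_ne_zero (b + j)
    positivity
  rw [div_eq_iff (hne _ _)]
  simp only [Finset.prod_mul_distrib, Finset.prod_div_distrib, Finset.prod_const,
    Finset.card_range]
  rw [Finset.prod_range_succ (fun j => (j.factorial : ℝ)),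
    Finset.prod_range_succ' (fun j => ((a + j).factorial : ℝ))]
  have e4 : ∀ j, a + 1 + j = a + (j + 1) := fun j => by ring
  simp only [e4, add_zero]
  have hp : ∏ j ∈ Finset.range s, ((a + (j + 1)).factorial : ℝ) ≠ 0 :=
    Finset.prod_ne_zero_iff.mpr fun j _ => by positivity
  field_simp
  ring
end

section
/- Let n ≥ 1 be an integer, T > 0 a real number, and for 0 ≤ k ≤ n−1 define the polynomial p^n_k(z) = (k!/(n−k−1)!) · Σ_{ℓ=0}^{k} ((n−1−ℓ)!/((k−ℓ)! · ℓ!)) · (−Tz)^ℓ. Then for any radius R > 0 and any 0 ≤ k, j ≤ n−1, the contour integral (1/(2πi)) ∮_{|z|=R} p^n_k(z) · p^n_j(z) · e^{Tz} · z^{−n} dz equals 0 if k ≠ j, and equals (−1)^k · (k!/(n−1−k)!) · T^{n−1} if k = j. -/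
/-- The polynomial `p^n_k(z) = (k!/(n-k-1)!) Σ_{ℓ=0}^k ((n-1-ℓ)!/((k-ℓ)! ℓ!)) (-Tz)^ℓ`
from Lemma 5.4. -/
noncomputable def pnk (n k : ℕ) (T : ℝ) (z : ℂ) : ℂ :=
  ((k.factorial : ℂ) / ((n - k - 1).factorial : ℂ)) *
    ∑ ℓ ∈ Finset.range (k + 1),
      (((n - 1 - ℓ).factorial : ℂ) / (((k - ℓ).factorial * ℓ.factorial : ℕ) : ℂ)) *
        (-(T : ℂ) * z) ^ ℓ

/-- The residue integrals `∮ e^{Tz} z^{-m-1} dz`. -/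
lemma aux_int_neg (T : ℂ) (R : ℝ) (hR : 0 < R) (m : ℕ) :
    (∮ z in C(0, R), Complex.exp (T * z) * z ^ (-((m : ℤ) + 1))) =
      2 * (Real.pi : ℂ) * Complex.I * (T ^ m / (m.factorial : ℂ)) := by
  have hne : ∀ z ∈ Metric.sphere (0 : ℂ) R, z ≠ 0 := by
    intro z hz h0
    simp [h0] at hz
    exact hR.ne hz
  have hci : ∀ p : ℤ, CircleIntegrable (fun z : ℂ => Complex.exp (T * z) * z ^ p) 0 R := by
    intro p
    apply ContinuousOn.circleIntegrable hR.le
    apply ContinuousOn.mul (by fun_prop)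
    exact fun z hz => (continuousAt_zpow₀ z p (Or.inl (hne z hz))).continuousWithinAt
  induction m with
  | zero =>
    have h := DifferentiableOn.circleIntegral_sub_inv_smul (R := R) (c := 0) (w := 0)
      (f := fun z : ℂ => Complex.exp (T * z))
      (by fun_prop) (by simpa using hR)
    simp only [sub_zero, smul_eq_mul, mul_zero, Complex.exp_zero] at h
    simp only [Nat.cast_zero, zero_add, zpow_neg_one, pow_zero, Nat.factorial_zero, Nat.cast_one,
      div_one]
    rw [← h]
    congr 1
    ext z
    ring
  | succ m ih =>
    have key : (∮ z in C(0, R), (T * (Complex.exp (T * z) * z ^ (-((m : ℤ) + 1))) -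
        ((m : ℂ) + 1) * (Complex.exp (T * z) * z ^ (-(((m + 1 : ℕ) : ℤ) + 1))))) = 0 := by
      apply circleIntegral.integral_eq_zero_of_hasDerivWithinAt hR.le
        (f := fun z => Complex.exp (T * z) * z ^ (-((m : ℤ) + 1)))
      intro z hz
      have h1 : HasDerivAt (fun z : ℂ => Complex.exp (T * z)) (Complex.exp (T * z) * (T * 1)) z :=
        ((hasDerivAt_id z).const_mul T).cexp
      have h2 := hasDerivAt_zpow (-((m : ℤ) + 1)) z (Or.inl (hne z hz))
      refine HasDerivWithinAt.congr_deriv (h1.mul h2).hasDerivWithinAt ?_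
      have : (-((m : ℤ) + 1) - 1) = -(((m + 1 : ℕ) : ℤ) + 1) := by push_cast; ring
      rw [this]
      push_cast
      ring
    rw [circleIntegral.integral_sub, circleIntegral.integral_const_mul,
      circleIntegral.integral_const_mul, ih] at key
    · have hm : (m : ℂ) + 1 ≠ 0 := by exact_mod_cast Nat.succ_ne_zero m
      have hf : (m.factorial : ℂ) ≠ 0 := by exact_mod_cast m.factorial_ne_zero
      apply mul_left_cancel₀ hm
      rw [← sub_eq_zero.mp key, Nat.factorial_succ]
      push_cast
      field_simp
      ring
    · simpa [Pi.smul_def] using (hci _).const_smul (a := T)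
    · simpa [Pi.smul_def] using (hci (-(((m + 1 : ℕ) : ℤ) + 1))).const_smul (a := (m : ℂ) + 1)

lemma aux_int (T : ℂ) (R : ℝ) (hR : 0 < R) (N m : ℕ) :
    (∮ z in C(0, R), z ^ m * (Complex.exp (T * z) * z ^ (-((N + 1 : ℕ) : ℤ)))) =
      2 * (Real.pi : ℂ) * Complex.I *
        (if m ≤ N then T ^ (N - m) / ((N - m).factorial : ℂ) else 0) := by
  have hne : ∀ z ∈ Metric.sphere (0 : ℂ) R, z ≠ 0 := by
    intro z hz h0
    simp [h0] at hz
    exact hR.ne hz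
  split_ifs with h
  · rw [← aux_int_neg T R hR]
    apply circleIntegral.integral_congr hR.le
    intro z hz
    have hz0 := hne z hz
    have : (-(((N - m : ℕ) : ℤ) + 1)) = (m : ℤ) + (-((N + 1 : ℕ) : ℤ)) := by
      push_cast [h]; ring
    simp only
    rw [this, zpow_add₀ hz0, zpow_natCast]
    ring
  · rw [mul_zero]
    rw [circleIntegral.integral_congr (g := fun z => z ^ (m - (N + 1)) * Complex.exp (T * z)) hR.le]
    · apply DiffContOnCl.circleIntegral_eq_zero hR.le
      apply Differentiable.diffContOnCl
      fun_prop
    · intro z hz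
      have hz0 := hne z hz
      obtain ⟨d, rfl⟩ : ∃ d, m = N + 1 + d := ⟨m - (N + 1), by omega⟩
      simp only [zpow_neg, zpow_natCast, Nat.add_sub_cancel_left, pow_add z (N + 1) d]
      field_simp

/-- Finite difference identity. -/
lemma aux_comb (N k m : ℕ) (hm : m ≤ k) (hk : k ≤ N) :
    ∑ l ∈ Finset.range (k + 1), (-1 : ℤ) ^ l * (k.choose l : ℤ) * ((N - l).choose m : ℤ) =
      if k = m then 1 else 0 := by
  have h := fwdDiff_iter_eq_sum_shift (1 : ℕ) (fun x : ℕ => (x.choose m : ℤ)) k (N - k)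
  have h2 : (fwdDiff (1 : ℕ))^[k] (fun x : ℕ => (x.choose m : ℤ)) (N - k) =
      if k = m then 1 else 0 := by
    have h0 := fwdDiff_iter_choose 0 m
    simp only [add_zero, Nat.choose_zero_right, Nat.cast_one] at h0
    split_ifs with hkm
    · subst hkm
      rw [h0]
    · obtain ⟨d, rfl⟩ : ∃ d, k = d + 1 + m := ⟨k - m - 1, by omega⟩
      rw [Function.iterate_add_apply, h0, Function.iterate_add_apply]
      simp only [Function.iterate_one, fwdDiff_const]
      simp [fwdDiff_iter_eq_sum_shift]
  rw [← h2, h, ← Finset.sum_range_reflect]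
  apply Finset.sum_congr rfl
  intro i hi
  have hi' : i ≤ k := by simpa [Nat.lt_succ_iff] using hi
  have e1 : k + 1 - 1 - i = k - i := by omega
  have e2 : N - (k - i) = N - k + i := by omega
  simp only [e1, e2, Nat.choose_symm hi', smul_eq_mul, mul_one]

lemma aux_pair (N k m : ℕ) (T : ℝ) (R : ℝ) (hR : 0 < R) (hm : m ≤ k) (hk : k ≤ N) :
    (∮ z in C(0, R), (-(T : ℂ) * z) ^ m * (pnk (N + 1) k T z *
        (Complex.exp ((T : ℂ) * z) * z ^ (-((N + 1 : ℕ) : ℤ))))) =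
      2 * (Real.pi : ℂ) * Complex.I * (if k = m then
        (-1 : ℂ) ^ k * ((k.factorial : ℂ) / ((N - k).factorial : ℂ)) * (T : ℂ) ^ N
      else 0) := by
  have hne : ∀ z ∈ Metric.sphere (0 : ℂ) R, z ≠ 0 := by
    intro z hz h0
    simp [h0] at hz
    exact hR.ne hz
  have hci : ∀ (c : ℂ) (q : ℕ), CircleIntegrable (fun z : ℂ => c * (z ^ q * (Complex.exp (T * z) *
      z ^ (-((N + 1 : ℕ) : ℤ))))) 0 R := by
    intro c q
    apply ContinuousOn.circleIntegrable hR.le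
    apply ContinuousOn.mul (by fun_prop)
    apply ContinuousOn.mul (by fun_prop)
    apply ContinuousOn.mul (by fun_prop)
    exact fun z hz => (continuousAt_zpow₀ z _ (Or.inl (hne z hz))).continuousWithinAt
  have hexp : ∀ z : ℂ, (-(T : ℂ) * z) ^ m * (pnk (N + 1) k T z *
        (Complex.exp ((T : ℂ) * z) * z ^ (-((N + 1 : ℕ) : ℤ)))) =
      ∑ l ∈ Finset.range (k + 1), (((k.factorial : ℂ) / ((N - k).factorial : ℂ)) *
        (((N - l).factorial : ℂ) / (((k - l).factorial * l.factorial : ℕ) : ℂ)) *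
          (-(T : ℂ)) ^ (l + m)) * (z ^ (l + m) * (Complex.exp ((T : ℂ) * z) *
            z ^ (-((N + 1 : ℕ) : ℤ)))) := by
    intro z
    have e : N + 1 - k - 1 = N - k := by omega
    simp only [pnk, e, Nat.add_sub_cancel]
    rw [Finset.mul_sum, Finset.sum_mul, Finset.mul_sum]
    apply Finset.sum_congr rfl
    intro l _
    rw [mul_pow, mul_pow, pow_add, pow_add]
    ring
  simp only [hexp]
  rw [circleIntegral.integral_fun_sum (fun l _ => hci _ _)]
  simp only [circleIntegral.integral_const_mul, aux_int _ R hR]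
  have hterm : ∀ l ∈ Finset.range (k + 1), (((k.factorial : ℂ) / ((N - k).factorial : ℂ)) *
        (((N - l).factorial : ℂ) / (((k - l).factorial * l.factorial : ℕ) : ℂ)) *
          (-(T : ℂ)) ^ (l + m)) * (2 * (Real.pi : ℂ) * Complex.I *
        (if l + m ≤ N then (T : ℂ) ^ (N - (l + m)) / ((N - (l + m)).factorial : ℂ) else 0)) =
      (2 * (Real.pi : ℂ) * Complex.I * ((-1) ^ m * (m.factorial : ℂ) / ((N - k).factorial : ℂ)
        * (T : ℂ) ^ N)) *
        (((-1 : ℤ) ^ l * (k.choose l : ℤ) * ((N - l).choose m : ℤ) : ℤ) : ℂ) := by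
    intro l hl
    have hl' : l ≤ k := by simpa [Nat.lt_succ_iff] using hl
    split_ifs with hle
    · have f1 : (((N - k).factorial : ℕ) : ℂ) ≠ 0 := by exact_mod_cast Nat.factorial_ne_zero _
      have f2 : (((N - (l + m)).factorial : ℕ) : ℂ) ≠ 0 := by
        exact_mod_cast Nat.factorial_ne_zero _
      have f3 : (((k - l).factorial : ℕ) : ℂ) ≠ 0 := by exact_mod_cast Nat.factorial_ne_zero _
      have f4 : ((l.factorial : ℕ) : ℂ) ≠ 0 := by exact_mod_cast Nat.factorial_ne_zero _
      have c1 : (k.choose l : ℂ) * (l.factorial : ℂ) * ((k - l).factorial : ℂ) = k.factorial := by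
        exact_mod_cast Nat.choose_mul_factorial_mul_factorial hl'
      have c2 : ((N - l).choose m : ℂ) * (m.factorial : ℂ) * ((N - (l + m)).factorial : ℂ) =
          (N - l).factorial := by
        have := Nat.choose_mul_factorial_mul_factorial (n := N - l) (k := m) (by omega)
        rw [Nat.sub_sub] at this
        exact_mod_cast this
      have c3 : (T : ℂ) ^ N = (T : ℂ) ^ (l + m) * (T : ℂ) ^ (N - (l + m)) := by
        rw [← pow_add]; congr 1; omega
      rw [← c1, ← c2, c3, neg_pow (T : ℂ) (l + m), pow_add (-1 : ℂ)]
      push_cast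
      field_simp
    · rw [Nat.choose_eq_zero_of_lt (by omega : N - l < m)]
      simp
  rw [Finset.sum_congr rfl hterm, ← Finset.mul_sum, ← Int.cast_sum, aux_comb N k m hm hk]
  split_ifs with h
  · subst h
    push_cast
    ring
  · simp

lemma aux_main_s9 (N k j : ℕ) (T : ℝ) (R : ℝ) (hR : 0 < R) (hm : j ≤ k) (hk : k ≤ N) :
    (∮ z in C(0, R), pnk (N + 1) j T z * (pnk (N + 1) k T z *
        (Complex.exp ((T : ℂ) * z) * z ^ (-((N + 1 : ℕ) : ℤ))))) =
      2 * (Real.pi : ℂ) * Complex.I * (if k = j then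
        (-1 : ℂ) ^ k * ((k.factorial : ℂ) / ((N - k).factorial : ℂ)) * (T : ℂ) ^ N
      else 0) := by
  have hne : ∀ z ∈ Metric.sphere (0 : ℂ) R, z ≠ 0 := by
    intro z hz h0
    simp [h0] at hz
    exact hR.ne hz
  have hci : ∀ (c : ℂ) (q : ℕ), CircleIntegrable (fun z : ℂ => c * ((-(T : ℂ) * z) ^ q *
      (pnk (N + 1) k T z * (Complex.exp (T * z) * z ^ (-((N + 1 : ℕ) : ℤ)))))) 0 R := by
    intro c q
    apply ContinuousOn.circleIntegrable hR.le
    apply ContinuousOn.mul (by fun_prop)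
    apply ContinuousOn.mul (by fun_prop)
    apply ContinuousOn.mul (by unfold pnk; fun_prop)
    apply ContinuousOn.mul (by fun_prop)
    exact fun z hz => (continuousAt_zpow₀ z _ (Or.inl (hne z hz))).continuousWithinAt
  have hexp : ∀ z : ℂ, pnk (N + 1) j T z * (pnk (N + 1) k T z *
        (Complex.exp ((T : ℂ) * z) * z ^ (-((N + 1 : ℕ) : ℤ)))) =
      ∑ l ∈ Finset.range (j + 1), (((j.factorial : ℂ) / ((N - j).factorial : ℂ)) *
        (((N - l).factorial : ℂ) / (((j - l).factorial * l.factorial : ℕ) : ℂ))) *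
          ((-(T : ℂ) * z) ^ l * (pnk (N + 1) k T z * (Complex.exp ((T : ℂ) * z) *
            z ^ (-((N + 1 : ℕ) : ℤ))))) := by
    intro z
    have e : N + 1 - j - 1 = N - j := by omega
    have e' : pnk (N + 1) j T z = ((j.factorial : ℂ) / ((N - j).factorial : ℂ)) *
        ∑ l ∈ Finset.range (j + 1),
        (((N - l).factorial : ℂ) / (((j - l).factorial * l.factorial : ℕ) : ℂ)) *
        (-(T : ℂ) * z) ^ l := by
      simp only [pnk, e, Nat.add_sub_cancel]
    rw [e', Finset.mul_sum, Finset.sum_mul]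
    apply Finset.sum_congr rfl
    intro l _
    ring
  simp only [hexp]
  rw [circleIntegral.integral_fun_sum (fun l _ => hci _ _)]
  simp only [circleIntegral.integral_const_mul]
  rw [Finset.sum_range_succ, Finset.sum_eq_zero, zero_add, aux_pair N k j T R hR hm hk]
  · split_ifs with h
    · subst h
      have f1 : (((N - k).factorial : ℕ) : ℂ) ≠ 0 := by exact_mod_cast Nat.factorial_ne_zero _
      have f4 : ((k.factorial : ℕ) : ℂ) ≠ 0 := by exact_mod_cast Nat.factorial_ne_zero _
      simp only [Nat.sub_self, Nat.factorial_zero, one_mul]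
      field_simp
    · simp
  · intro l hl
    have hl' : l < j := by simpa using hl
    rw [aux_pair N k l T R hR (by omega) hk, if_neg (by omega)]
    simp

/-- Lemma 5.4, orthogonality: the polynomials `p^n_k` are orthogonal for the
pairing `⟨f,g⟩_n = (1/(2πi)) ∮_{|z|=R} f(z) g(z) e^{Tz} z^{-n} dz`, with squared norm
`(-1)^k (k!/(n-1-k)!) T^{n-1}`. -/
theorem pnk_orthogonal (n : ℕ) (hn : 1 ≤ n) (T : ℝ) (hT : 0 < T) (R : ℝ) (hR : 0 < R)
    (k j : ℕ) (hk : k ≤ n - 1) (hj : j ≤ n - 1) :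
    (1 / (2 * (Real.pi : ℂ) * Complex.I)) *
        (∮ z in C(0, R),
          pnk n k T z * pnk n j T z * Complex.exp ((T : ℂ) * z) * z ^ (-(n : ℤ))) =
      if k = j then
        (-1 : ℂ) ^ k * ((k.factorial : ℂ) / ((n - 1 - k).factorial : ℂ)) * (T : ℂ) ^ (n - 1)
      else 0 := by
  obtain ⟨N, rfl⟩ : ∃ N, n = N + 1 := ⟨n - 1, by omega⟩
  simp only [Nat.add_sub_cancel] at hk hj ⊢
  have h2 : (2 * (Real.pi : ℂ) * Complex.I) ≠ 0 := Complex.two_pi_I_ne_zero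
  rw [one_div, inv_mul_eq_iff_eq_mul₀ h2]
  rcases le_total j k with h | h
  · rw [← aux_main_s9 N k j T R hR h hk]
    congr 1
    ext z
    ring
  · have := aux_main_s9 N j k T R hR h hj
    have e : (if k = j then
        (-1 : ℂ) ^ k * ((k.factorial : ℂ) / ((N - k).factorial : ℂ)) * (T : ℂ) ^ N
      else 0) = (if j = k then
        (-1 : ℂ) ^ j * ((j.factorial : ℂ) / ((N - j).factorial : ℂ)) * (T : ℂ) ^ N
      else 0) := by
      by_cases hkj : k = j
      · subst hkj; rfl
      · rw [if_neg hkj, if_neg (Ne.symm hkj)]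
    rw [e, ← this]
    congr 1
    ext z
    ring
end

section
/- Let n ≥ 1 be an integer, 0 ≤ k ≤ n−1, T > 0 a real number, and z ∈ ℂ with z ≠ 0. Define p^n_k(z) = (k!/(n−k−1)!) · Σ_{ℓ=0}^{k} ((n−1−ℓ)!/((k−ℓ)! · ℓ!)) · (−Tz)^ℓ. Then p^n_k(z) = (T^n · (−z)^k / (n−1−k)!) · ∫_0^∞ (1 − y/z)^k · y^{n−1−k} · e^{−Ty} dy. -/
open MeasureTheory

lemma pnk_aux_integral (m : ℕ) (T : ℝ) (hT : 0 < T) :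
    ∫ y in Set.Ioi (0 : ℝ), (y : ℂ) ^ m * Complex.exp (-(T : ℂ) * (y : ℂ))
      = (m.factorial : ℂ) / (T : ℂ) ^ (m + 1) := by
  have h := Complex.integral_cpow_mul_exp_neg_mul_Ioi (a := (m : ℂ) + 1) (r := T)
    (by simp; positivity) hT
  rw [Complex.Gamma_nat_eq_factorial] at h
  have e : (1 / (T : ℂ)) ^ ((m : ℂ) + 1) = (1 / (T : ℂ)) ^ (m + 1) := by
    rw [← Complex.cpow_natCast]; push_cast; rfl
  rw [e] at h
  simp only [add_sub_cancel_right, Complex.cpow_natCast, ← neg_mul] at h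
  rw [h]
  rw [one_div, inv_pow, div_eq_inv_mul]

lemma pnk_aux_integrable (m : ℕ) (T : ℝ) (hT : 0 < T) :
    IntegrableOn (fun y : ℝ => (y : ℂ) ^ m * Complex.exp (-(T : ℂ) * (y : ℂ)))
      (Set.Ioi (0 : ℝ)) := by
  by_contra hc
  have h := pnk_aux_integral m T hT
  rw [integral_undef hc] at h
  have hT' : (T : ℂ) ≠ 0 := by exact_mod_cast hT.ne'
  have : (m.factorial : ℂ) / (T : ℂ) ^ (m + 1) ≠ 0 :=
    div_ne_zero (by exact_mod_cast m.factorial_ne_zero) (pow_ne_zero _ hT')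
  exact this h.symm

/-- Lemma 5.4, first integral representation:
`p^n_k(z) = (T^n (-z)^k / (n-1-k)!) ∫_0^∞ (1 - y/z)^k y^{n-1-k} e^{-Ty} dy`. -/
theorem pnk_integral_rep (n : ℕ) (hn : 1 ≤ n) (k : ℕ) (hk : k ≤ n - 1) (T : ℝ) (hT : 0 < T)
    (z : ℂ) (hz : z ≠ 0) :
    pnk n k T z =
      ((T : ℂ) ^ n * (-z) ^ k / ((n - 1 - k).factorial : ℂ)) *
        ∫ y in Set.Ioi (0 : ℝ),
          (1 - (y : ℂ) / z) ^ k * (y : ℂ) ^ (n - 1 - k) * Complex.exp (-(T : ℂ) * (y : ℂ)) := by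
  obtain ⟨m, rfl⟩ : ∃ m, n = k + m + 1 := ⟨n - 1 - k, by omega⟩
  have hT' : (T : ℂ) ≠ 0 := by exact_mod_cast hT.ne'
  have e1 : k + m + 1 - 1 - k = m := by omega
  have e2 : k + m + 1 - k - 1 = m := by omega
  have key : (-z) ^ k * ∫ y in Set.Ioi (0 : ℝ),
      (1 - (y : ℂ) / z) ^ k * (y : ℂ) ^ m * Complex.exp (-(T : ℂ) * (y : ℂ))
      = ∑ l ∈ Finset.range (k + 1), ((-z) ^ l * (k.choose l : ℂ)) *
        (((k + m - l).factorial : ℂ) / (T : ℂ) ^ (k + m - l + 1)) := by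
    rw [← integral_const_mul]
    simp_rw [← pnk_aux_integral _ T hT, ← integral_const_mul]
    rw [← integral_finsetSum _ (fun l _ => (pnk_aux_integrable _ T hT).const_mul _)]
    congr 1
    ext y
    have h1 : (-z) ^ k * (1 - (y : ℂ) / z) ^ k = (-z + y) ^ k := by
      rw [← mul_pow]; congr 1; field_simp; ring
    rw [← mul_assoc, ← mul_assoc, h1, add_pow, Finset.sum_mul, Finset.sum_mul]
    refine Finset.sum_congr rfl fun l hl => ?_
    have hl' : l ≤ k := by simpa [Nat.lt_succ_iff] using hl
    rw [show k + m - l = (k - l) + m by omega, pow_add]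
    ring
  rw [e1, mul_div_assoc, mul_assoc, div_mul_eq_mul_div, key, pnk, e2, Finset.mul_sum,
    Finset.sum_div, Finset.mul_sum]
  refine Finset.sum_congr rfl fun l hl => ?_
  have hl' : l ≤ k := by simpa [Nat.lt_succ_iff] using hl
  obtain ⟨j, rfl⟩ := Nat.exists_eq_add_of_le hl'
  rw [Nat.cast_choose ℂ hl']
  rw [show l + j + m + 1 - 1 - l = j + m by omega, show l + j - l = j by omega,
    show l + j + m - l = j + m by omega]
  have a1 : (m.factorial : ℂ) ≠ 0 := by exact_mod_cast m.factorial_ne_zero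
  have a2 : (l.factorial : ℂ) ≠ 0 := by exact_mod_cast l.factorial_ne_zero
  have a3 : (j.factorial : ℂ) ≠ 0 := by exact_mod_cast j.factorial_ne_zero
  rw [show l + j + m + 1 = l + (j + m + 1) by omega, pow_add (T : ℂ) l, neg_mul, ← mul_neg, mul_pow]
  push_cast
  field_simp
end

section
/- Fix an integer N ≥ 1 and a real T_0 > 0, and index matrices by pairs (k,n) with 1 ≤ k ≤ n ≤ N. For T > 0 define the matrix Y^{T_0}(T) by [Y^{T_0}(T)]_{(k,n),(k',n')} = (T_0/T)^{n−1} · ((T−T_0)/T_0)^{n−n'} · C(k−1, k'−1) · C(n−k, n'−k') when k' ≤ k and n'−k' ≤ n−k (in which case n' ≤ n), and 0 otherwise, where C(·,·) is the binomial coefficient. Define A(T) by [A(T)]_{(k,n),(k,n)} = (1−n)/T, [A(T)]_{(k,n),(k−1,n−1)} = (k−1)/T, [A(T)]_{(k,n),(k,n−1)} = (n−k)/T, and all other entries 0. Then Y^{T_0}(T_0) is the identity matrix, and for every T > 0 and all index pairs, the function T ↦ [Y^{T_0}(T)]_{(k,n),(k',n')} is differentiable at T with derivative equal to the corresponding entry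 of the matrix product A(T) · Y^{T_0}(T). -/
/-- The entry `[Y^{T₀}(T)]_{(k,n),(k',n')}` of the propagator matrix (equation (5.28)):
`(T₀/T)^{n-1} ((T-T₀)/T₀)^{n-n'} C(k-1,k'-1) C(n-k,n'-k')` when `k' ≤ k` and
`n'-k' ≤ n-k`, and `0` otherwise. -/
noncomputable def propagatorEnt (T0 T : ℝ) (k n k' n' : ℕ) : ℝ :=
  if k' ≤ k ∧ n' - k' ≤ n - k then
    (T0 / T) ^ (n - 1) * ((T - T0) / T0) ^ (n - n') *
      ((k - 1).choose (k' - 1) : ℝ) * ((n - k).choose (n' - k') : ℝ)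
  else 0

/-- The entry `[A(T)]_{(k,n),(k'',n'')}` of the drift matrix: `(1-n)/T` on the diagonal,
`(k-1)/T` at `(k-1,n-1)`, `(n-k)/T` at `(k,n-1)`, and `0` otherwise. -/
noncomputable def driftEnt (T : ℝ) (k n k'' n'' : ℕ) : ℝ :=
  if k'' = k ∧ n'' = n then (1 - (n : ℝ)) / T
  else if k'' + 1 = k ∧ n'' + 1 = n then ((k : ℝ) - 1) / T
  else if k'' = k ∧ n'' + 1 = n then ((n : ℝ) - (k : ℝ)) / T
  else 0

theorem ent_eq (T0 T : ℝ) (a b c d : ℕ) :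
    propagatorEnt T0 T (a+1) (a+b+1) (c+1) (c+d+1) =
      (T0 / T) ^ (a+b) * ((T - T0) / T0) ^ (a+b-(c+d)) * (a.choose c : ℝ) * (b.choose d : ℝ) := by
  unfold propagatorEnt
  have h1 : a + b + 1 - (a+1) = b := by omega
  have h2 : c + d + 1 - (c+1) = d := by omega
  have h3 : a + b + 1 - (c+d+1) = a + b - (c+d) := by omega
  rw [h1, h2, h3]
  split_ifs with h
  · simp
  · have : a < c ∨ b < d := by omega
    rcases this with h | h
    · simp [Nat.choose_eq_zero_of_lt h]
    · simp [Nat.choose_eq_zero_of_lt h]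

theorem sum_single (N p q : ℕ) (x : ℝ) (f : ℕ → ℕ → ℝ) :
    (∑ n ∈ Finset.Icc 1 N, ∑ k ∈ Finset.Icc 1 n, (if k = p ∧ n = q then x else 0) * f k n)
      = if 1 ≤ p ∧ p ≤ q ∧ q ≤ N then x * f p q else 0 := by
  have h : ∀ n k : ℕ, (if k = p ∧ n = q then x else 0) * f k n =
      if k = p then (if n = q then x * f p q else 0) else 0 := by
    intro n k
    by_cases h1 : k = p
    · by_cases h2 : n = q
      · simp [h1, h2]
      · simp [h2]
    · simp [h1]
  simp only [h, Finset.sum_ite_eq', Finset.mem_Icc]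
  have h' : ∀ n : ℕ, (if 1 ≤ p ∧ p ≤ n then (if n = q then x * f p q else 0) else 0) =
      if n = q then (if 1 ≤ p ∧ p ≤ q then x * f p q else 0) else 0 := by
    intro n
    by_cases h2 : n = q
    · simp [h2]
    · simp [h2]
  simp only [h', Finset.sum_ite_eq', Finset.mem_Icc]
  by_cases h1 : 1 ≤ p ∧ p ≤ q
  · by_cases h2 : q ≤ N
    · have : 1 ≤ q := by omega
      simp [h1, h2, this]
    · simp [h2]
  · have : ¬ (1 ≤ p ∧ p ≤ q ∧ q ≤ N) := by tauto
    simp only [h1, this, if_false, ite_self]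

theorem drift_sum (N a b : ℕ) (T : ℝ) (hN : a + b + 1 ≤ N) (f : ℕ → ℕ → ℝ) :
    (∑ n ∈ Finset.Icc 1 N, ∑ k ∈ Finset.Icc 1 n, driftEnt T (a+1) (a+b+1) k n * f k n)
      = -((a:ℝ)+b)/T * f (a+1) (a+b+1) + (a:ℝ)/T * f a (a+b) + (b:ℝ)/T * f (a+1) (a+b) := by
  have h : ∀ k n : ℕ, driftEnt T (a+1) (a+b+1) k n * f k n =
      (if k = a+1 ∧ n = a+b+1 then -((a:ℝ)+b)/T else 0) * f k n
      + (if k = a ∧ n = a+b then (a:ℝ)/T else 0) * f k n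
      + (if k = a+1 ∧ n = a+b then (b:ℝ)/T else 0) * f k n := by
    intro k n
    rw [← add_mul, ← add_mul]
    congr 1
    unfold driftEnt
    simp only [Nat.add_right_cancel_iff]
    push_cast
    split_ifs <;> first | omega | ring
  simp only [h, Finset.sum_add_distrib, sum_single]
  congr 1
  · congr 1
    · rw [if_pos (by omega)]
    · split_ifs with h
      · rfl
      · have : a = 0 := by omega
        simp [this]
  · split_ifs with h
    · rfl
    · have : b = 0 := by omega
      simp [this]

theorem choose_id (a c : ℕ) :
    ((a+1 : ℕ) : ℝ) * (a.choose c : ℝ) = (((a+1 : ℕ) : ℝ) - c) * ((a+1).choose c : ℝ) := by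
  by_cases h : c ≤ a + 1
  · have := Nat.choose_mul_succ_eq a c
    have h2 : ((a.choose c * (a+1) : ℕ) : ℝ) = (((a+1).choose c * (a+1-c) : ℕ) : ℝ) := by rw [this]
    rw [Nat.cast_mul, Nat.cast_mul, Nat.cast_sub h] at h2
    linarith
  · rw [Nat.choose_eq_zero_of_lt (by omega), Nat.choose_eq_zero_of_lt (by omega)]
    simp

theorem left_id (T0 T : ℝ) (a b c d : ℕ) :
    (a:ℝ) * propagatorEnt T0 T a (a+b) (c+1) (c+d+1) =
      (T0 / T) ^ (a+b-1) * ((T - T0) / T0) ^ (a+b-(c+d)-1) *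
        (((a:ℝ) - c) * (a.choose c : ℝ)) * (b.choose d : ℝ) := by
  cases a with
  | zero => cases c <;> simp
  | succ a =>
    have e : a + 1 + b = a + b + 1 := by omega
    have e2 : a + b + 1 - (c+d) - 1 = a + b - (c+d) := by omega
    rw [e, ent_eq, ← choose_id, e2, Nat.add_sub_cancel]
    ring

theorem right_id (T0 T : ℝ) (a b c d : ℕ) :
    (b:ℝ) * propagatorEnt T0 T (a+1) (a+b) (c+1) (c+d+1) =
      (T0 / T) ^ (a+b-1) * ((T - T0) / T0) ^ (a+b-(c+d)-1) *
        (a.choose c : ℝ) * (((b:ℝ) - d) * (b.choose d : ℝ)) := by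
  cases b with
  | zero => cases d <;> simp
  | succ b =>
    have e : a + (b + 1) = a + b + 1 := by omega
    have e2 : a + b + 1 - (c+d) - 1 = a + b - (c+d) := by omega
    rw [e, ent_eq, ← choose_id, e2, Nat.add_sub_cancel]
    ring

theorem deriv_core (T0 T : ℝ) (h0 : 0 < T0) (hT : 0 < T) (s m : ℕ) (hm : m ≤ s) :
    HasDerivAt (fun t : ℝ => (T0 / t) ^ s * ((t - T0) / T0) ^ m)
      (-(s:ℝ)/T * ((T0 / T) ^ s * ((T - T0) / T0) ^ m) +
        (m:ℝ)/T * ((T0 / T) ^ (s-1) * ((T - T0) / T0) ^ (m-1))) T := by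
  have h1 : HasDerivAt (fun t : ℝ => T0 / t) (-T0 / T^2) T := by
    have h := (hasDerivAt_const T T0).fun_div (hasDerivAt_id T) hT.ne'
    refine h.congr_deriv ?_
    simp
  have h2 : HasDerivAt (fun t : ℝ => (t - T0) / T0) (1 / T0) T :=
    ((hasDerivAt_id T).sub_const T0).div_const T0
  have h := (h1.fun_pow s).fun_mul (h2.fun_pow m)
  refine h.congr_deriv ?_
  have hT' := hT.ne'
  have h0' := h0.ne'
  generalize (T - T0) / T0 = x
  rcases s with _ | s
  · obtain rfl : m = 0 := by omega
    simp
  · simp only [Nat.add_sub_cancel, pow_succ (T0 / T) s]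
    generalize (T0 / T) ^ s = y
    field_simp

/-- Corollary 5.9: the propagator `Y^{T₀}` equals the identity at `T = T₀`
and solves the matrix ODE `dY^{T₀}/dT = A(T) Y^{T₀}(T)`, entries being indexed by pairs
`(k,n)` with `1 ≤ k ≤ n ≤ N`. -/
theorem propagator_solves_ODE (N : ℕ) (hN : 1 ≤ N) (T0 : ℝ) (hT0 : 0 < T0) :
    (∀ k n k' n' : ℕ, 1 ≤ k → k ≤ n → n ≤ N → 1 ≤ k' → k' ≤ n' → n' ≤ N →
      propagatorEnt T0 T0 k n k' n' = if k = k' ∧ n = n' then 1 else 0) ∧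
    (∀ T : ℝ, 0 < T → ∀ k n k' n' : ℕ, 1 ≤ k → k ≤ n → n ≤ N → 1 ≤ k' → k' ≤ n' → n' ≤ N →
      HasDerivAt (fun t => propagatorEnt T0 t k n k' n')
        (∑ n'' ∈ Finset.Icc 1 N, ∑ k'' ∈ Finset.Icc 1 n'',
          driftEnt T k n k'' n'' * propagatorEnt T0 T k'' n'' k' n') T) := by
  constructor
  · intro k n k' n' hk hkn hn hk' hkn' hn'
    obtain ⟨a, rfl⟩ := Nat.exists_eq_add_of_le' hk
    obtain ⟨c, rfl⟩ := Nat.exists_eq_add_of_le' hk'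
    obtain ⟨b, rfl⟩ : ∃ b, n = a + b + 1 := ⟨n - (a+1), by omega⟩
    obtain ⟨d, rfl⟩ : ∃ d, n' = c + d + 1 := ⟨n' - (c+1), by omega⟩
    rw [ent_eq, div_self hT0.ne', sub_self, zero_div]
    split_ifs with h
    · obtain rfl : a = c := by omega
      obtain rfl : b = d := by omega
      simp
    · by_cases h1 : a < c
      · simp [Nat.choose_eq_zero_of_lt h1]
      by_cases h2 : b < d
      · simp [Nat.choose_eq_zero_of_lt h2]
      have : a + b - (c+d) ≠ 0 := by omega
      simp [this]
  · intro T hT k n k' n' hk hkn hn hk' hkn' hn'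
    obtain ⟨a, rfl⟩ := Nat.exists_eq_add_of_le' hk
    obtain ⟨c, rfl⟩ := Nat.exists_eq_add_of_le' hk'
    obtain ⟨b, rfl⟩ : ∃ b, n = a + b + 1 := ⟨n - (a+1), by omega⟩
    obtain ⟨d, rfl⟩ : ∃ d, n' = c + d + 1 := ⟨n' - (c+1), by omega⟩
    rw [drift_sum N a b T hn (fun k n => propagatorEnt T0 T k n (c+1) (c+d+1))]
    simp only [div_mul_eq_mul_div (a:ℝ), div_mul_eq_mul_div (b:ℝ), left_id, right_id, ent_eq]
    have h := ((deriv_core T0 T hT0 hT (a+b) (a+b-(c+d)) (by omega)).mul_const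
      (a.choose c : ℝ)).mul_const (b.choose d : ℝ)
    refine h.congr_deriv ?_
    by_cases h1 : a < c
    · simp [Nat.choose_eq_zero_of_lt h1]
    by_cases h2 : b < d
    · simp [Nat.choose_eq_zero_of_lt h2]
    rw [Nat.cast_sub (by omega : c + d ≤ a + b)]
    push_cast
    ring
end

section
/- Let R_1, R_2 ∈ ℝ with R_1 > R_2 and let I_1, I_2 > 0 be real. Set κ = 2√(I_1 I_2) / √((R_1−R_2)² + (I_1+I_2)²), which lies in (0,1), and let 𝕂(κ) = ∫_0^1 dx / √((1−x²)(1−κ²x²)) be the complete elliptic integral of the first kind. Then the (ℂ-valued) double integral (4/π²) · ∫_{−I_2}^{I_2} ∫_{−I_1}^{I_1} [1 / ((R_1−R_2) + i(Y−X))] · [1 / (√(I_1²−Y²) · √(I_2²−X²))] dY dX equals the real number (4κ / (π·√(I_1 I_2))) · 𝕂(κ). -/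
open MeasureTheory intervalIntegral in
theorem aux_subst {E : Type*} [NormedAddCommGroup E] [NormedSpace ℝ E] (c : ℝ) (hc : 0 < c)
    (α β : ℝ) (h1 : -(Real.pi / 2) ≤ α) (h2 : β ≤ Real.pi / 2) (hab : α ≤ β) (g h : ℝ → E)
    (hg : ∀ t ∈ Set.Ioo α β, (c * Real.cos t) • g (c * Real.sin t) = h t) :
    ∫ x in (c * Real.sin α)..(c * Real.sin β), g x = ∫ t in α..β, h t := by
  have mono : StrictMonoOn (fun t => c * Real.sin t) (Set.Icc α β) := by
    intro x hx y hy hxy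
    have := Real.strictMonoOn_sin (Set.Icc_subset_Icc h1 h2 hx) (Set.Icc_subset_Icc h1 h2 hy) hxy
    exact mul_lt_mul_of_pos_left this hc
  have him : (fun t => c * Real.sin t) '' Set.Ioo α β
      = Set.Ioo (c * Real.sin α) (c * Real.sin β) := by
    apply Set.Subset.antisymm
    · rintro _ ⟨t, ht, rfl⟩
      exact ⟨mono ⟨le_rfl, hab⟩ (Set.Ioo_subset_Icc_self ht) ht.1,
        mono (Set.Ioo_subset_Icc_self ht) ⟨hab, le_rfl⟩ ht.2⟩
    · exact intermediate_value_Ioo hab (f := fun t => c * Real.sin t) (by fun_prop)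
  have hle : c * Real.sin α ≤ c * Real.sin β :=
    mono.monotoneOn ⟨le_rfl, hab⟩ ⟨hab, le_rfl⟩ hab
  rw [integral_of_le hle, integral_of_le hab, integral_Ioc_eq_integral_Ioo,
    integral_Ioc_eq_integral_Ioo, ← him,
    integral_image_eq_integral_abs_deriv_smul (f' := fun t => c * Real.cos t) measurableSet_Ioo
      (fun x _ => ((Real.hasDerivAt_sin x).const_mul c).hasDerivWithinAt)
      (mono.injOn.mono Set.Ioo_subset_Icc_self)]
  apply setIntegral_congr_fun measurableSet_Ioo
  intro t ht
  have : 0 < Real.cos t := Real.cos_pos_of_mem_Ioo ⟨by linarith [ht.1], by linarith [ht.2]⟩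
  simp only
  rw [abs_of_pos (mul_pos hc this), hg t ht]

theorem aux_weight (a : ℝ) (ha : 0 < a) (f : ℝ → ℂ) :
    ∫ Y in (-a)..a, f Y * (1 / (Real.sqrt (a ^ 2 - Y ^ 2) : ℂ))
      = ∫ t in (-(Real.pi / 2))..(Real.pi / 2), f (a * Real.sin t) := by
  have := aux_subst a ha (-(Real.pi / 2)) (Real.pi / 2) le_rfl le_rfl (by linarith [Real.pi_pos])
    (fun Y => f Y * (1 / (Real.sqrt (a ^ 2 - Y ^ 2) : ℂ))) (fun t => f (a * Real.sin t)) (by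
      intro t ht
      have hcos : 0 < Real.cos t := Real.cos_pos_of_mem_Ioo ht
      have : a ^ 2 - (a * Real.sin t) ^ 2 = (a * Real.cos t) ^ 2 := by
        have := Real.sin_sq_add_cos_sq t
        linear_combination (-a^2) * this
      have hne : ((a * Real.cos t : ℝ) : ℂ) ≠ 0 := by
        exact_mod_cast (mul_pos ha hcos).ne'
      rw [this, Real.sqrt_sq (mul_pos ha hcos).le, Complex.real_smul]
      field_simp)
  simpa using this

theorem aux_half (f : ℝ → ℂ) (hf : Continuous f) :
    ∫ t in (0:ℝ)..(2 * Real.pi), f (Real.sin t)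
      = 2 * ∫ t in (-(Real.pi / 2))..(Real.pi / 2), f (Real.sin t) := by
  have hper : Function.Periodic (fun t => f (Real.sin t)) (2 * Real.pi) := by
    intro t; simp
  have h1 := hper.intervalIntegral_add_eq 0 (-(Real.pi / 2))
  rw [zero_add] at h1
  have hc : Continuous (fun t => f (Real.sin t)) := by fun_prop
  rw [h1, ← intervalIntegral.integral_add_adjacent_intervals (b := Real.pi / 2)
    (hc.intervalIntegrable _ _) (hc.intervalIntegrable _ _)]
  have h2 := intervalIntegral.integral_comp_sub_left (a := -(Real.pi / 2)) (b := Real.pi / 2)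
    (fun t => f (Real.sin t)) Real.pi
  simp only [Real.sin_pi_sub] at h2
  rw [show Real.pi - Real.pi / 2 = Real.pi / 2 by ring,
    show Real.pi - -(Real.pi / 2) = -(Real.pi / 2) + 2 * Real.pi by ring] at h2
  rw [← h2]; ring

theorem aux_geom (α : ℂ) (hα : ‖α‖ < 1) :
    ∫ t in (0:ℝ)..(2 * Real.pi), (1 - α * Complex.exp (t * Complex.I))⁻¹ = 2 * Real.pi := by
  have hne : ∀ z : ℂ, ‖z‖ ≤ 1 → 1 - α * z ≠ 0 := by
    intro z hz h
    have : ‖α * z‖ = 1 := by rw [← sub_eq_zero.mp h]; simp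
    rw [norm_mul] at this
    nlinarith [norm_nonneg α, norm_nonneg z]
  have h := circleAverage_of_differentiable_on_off_countable (f := fun z : ℂ => (1 - α * z)⁻¹)
    (c := 0) (R := 1) (s := ∅) Set.countable_empty
    (by
      apply ContinuousOn.inv₀ (by fun_prop)
      intro z hz; exact hne z (by simpa using hz))
    (by
      intro z hz
      have : ‖z‖ < 1 := by simpa using hz.1
      exact DifferentiableAt.inv (by fun_prop) (hne z this.le))
  rw [Real.circleAverage_def] at h
  simp only [circleMap, zero_add, Complex.ofReal_one, one_mul, mul_zero, sub_zero, inv_one] at h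
  rw [Complex.real_smul] at h
  have hpi : (Real.pi : ℂ) ≠ 0 := by exact_mod_cast Real.pi_ne_zero
  push_cast at h
  field_simp at h
  simpa [one_div] using h

theorem aux_geom' (α : ℂ) (hα : ‖α‖ < 1) :
    ∫ t in (0:ℝ)..(2 * Real.pi), (1 - α * Complex.exp (-t * Complex.I))⁻¹ = 2 * Real.pi := by
  rw [← aux_geom α hα]
  have h2 := intervalIntegral.integral_comp_sub_left (a := 0) (b := 2 * Real.pi)
    (fun t : ℝ => (1 - α * Complex.exp (t * Complex.I))⁻¹) (2 * Real.pi)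
  rw [sub_self, sub_zero] at h2
  rw [← h2]
  congr 1
  ext t
  congr 3
  rw [Complex.exp_eq_exp_iff_exists_int]
  exact ⟨-1, by push_cast; ring⟩

theorem aux_inner (d p q : ℝ) (hd : 0 < d) :
    ∫ t in (0:ℝ)..(2 * Real.pi),
      1 / ((d : ℂ) + Complex.I * ((p * Real.sin t + q * Real.cos t : ℝ) : ℂ))
      = ((2 * Real.pi / Real.sqrt (d ^ 2 + p ^ 2 + q ^ 2) : ℝ) : ℂ) := by
  set s := Real.sqrt (d ^ 2 + p ^ 2 + q ^ 2) with hs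
  have hs2 : s ^ 2 = d ^ 2 + p ^ 2 + q ^ 2 := Real.sq_sqrt (by positivity)
  have hs0 : 0 < s := Real.sqrt_pos.mpr (by positivity)
  have hds : (0:ℝ) < d + s := by linarith
  have hdsC : ((d : ℂ) + s) ≠ 0 := by exact_mod_cast hds.ne'
  have hsC : (s : ℂ) ≠ 0 := by exact_mod_cast hs0.ne'
  have hs2C : (s : ℂ) ^ 2 = d ^ 2 + p ^ 2 + q ^ 2 := by exact_mod_cast hs2
  -- coefficients
  set α : ℂ := -((p : ℂ) + Complex.I * q) / (d + s) with hα
  set β : ℂ := -(-(p : ℂ) + Complex.I * q) / (d + s) with hβ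
  have nb : ∀ x : ℝ, x ^ 2 = p ^ 2 → ‖-((x : ℂ) + Complex.I * q) / (d + s)‖ < 1 := by
    intro x hx
    rw [norm_div, norm_neg]
    have e1 : ‖(d : ℂ) + s‖ = d + s := by
      rw [← Complex.ofReal_add, Complex.norm_real, Real.norm_of_nonneg hds.le]
    rw [e1, div_lt_one hds]
    have e2 : ‖(x : ℂ) + Complex.I * q‖ ^ 2 = p ^ 2 + q ^ 2 := by
      rw [Complex.sq_norm, Complex.normSq_apply]; simp; linarith
    nlinarith [norm_nonneg ((x : ℂ) + Complex.I * q), mul_pos hd hs0]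
  have nα : ‖α‖ < 1 := nb p rfl
  have nβ : ‖β‖ < 1 := by have := nb (-p) (by ring); push_cast at this; exact this
  have hne : ∀ γ z : ℂ, ‖γ‖ < 1 → ‖z‖ = 1 → 1 - γ * z ≠ 0 := by
    intro γ z hγ hz h
    have : ‖γ * z‖ = 1 := by rw [← sub_eq_zero.mp h]; simp
    rw [norm_mul, hz] at this
    linarith
  have n1 : ∀ t : ℝ, ‖Complex.exp (t * Complex.I)‖ = 1 := fun t => Complex.norm_exp_ofReal_mul_I t
  have n2 : ∀ t : ℝ, ‖Complex.exp (-t * Complex.I)‖ = 1 := fun t => by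
    have := n1 (-t); push_cast at this; exact this
  have key : ∀ t : ℝ, 1 / ((d : ℂ) + Complex.I * ((p * Real.sin t + q * Real.cos t : ℝ) : ℂ))
      = (1 / (s : ℂ)) * ((1 - α * Complex.exp (t * Complex.I))⁻¹
        + (1 - β * Complex.exp (-t * Complex.I))⁻¹ - 1) := by
    intro t
    have hz := hne α _ nα (n1 t)
    have hw := hne β _ nβ (n2 t)
    have hzw : Complex.exp (t * Complex.I) * Complex.exp (-t * Complex.I) = 1 := by
      rw [← Complex.exp_add]; simp
    have hden : (d : ℂ) + Complex.I * ((p * Real.sin t + q * Real.cos t : ℝ) : ℂ) ≠ 0 := by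
      intro h
      have := congrArg Complex.re h
      simp [-Complex.ofReal_add, -Complex.ofReal_mul] at this
      linarith
    have hsc : (d : ℂ) + Complex.I * ((p * Real.sin t + q * Real.cos t : ℝ) : ℂ)
        = d + (p + Complex.I * q) / 2 * Complex.exp (t * Complex.I)
          + (-p + Complex.I * q) / 2 * Complex.exp (-t * Complex.I) := by
      push_cast
      rw [Complex.sin, Complex.cos]
      linear_combination (p / 2 * (Complex.exp (-t * Complex.I) - Complex.exp (t * Complex.I))) * Complex.I_mul_I
    rw [hsc] at hden ⊢
    generalize Complex.exp (t * Complex.I) = z at *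
    generalize Complex.exp (-t * Complex.I) = w at *
    have hαβ : α * β * (d + s) ^ 2 = -(p ^ 2 + q ^ 2) := by
      rw [hα, hβ]; field_simp; linear_combination q^2 * Complex.I_sq
    have hprod : (1 - α * z) * (1 - β * w) * (d + s) = 2 * (d + (p + Complex.I * q) / 2 * z
          + (-p + Complex.I * q) / 2 * w) := by
      have ea : α * (d + s) = -(p + Complex.I * q) := by rw [hα]; field_simp
      have eb : β * (d + s) = -(-p + Complex.I * q) := by rw [hβ]; field_simp
      have eab : α * β * (d + s) = d - s := by
        apply mul_right_cancel₀ hdsC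
        linear_combination hαβ + hs2C
      linear_combination (-z) * ea - w * eb + eab + α * β * (d + s) * hzw
    have eab : α * β * (d + s) = d - s := by
      apply mul_right_cancel₀ hdsC
      linear_combination hαβ + hs2C
    have h3 : (1 - α * z)⁻¹ + (1 - β * w)⁻¹ - 1 = (1 - α * β) / ((1 - α * z) * (1 - β * w)) := by
      field_simp
      linear_combination (-α * β) * hzw
    rw [h3, div_mul_div_comm, div_eq_div_iff hden (mul_ne_zero hsC (mul_ne_zero hz hw))]
    apply mul_right_cancel₀ hdsC
    linear_combination s * hprod + (d + (p + Complex.I * q) / 2 * z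
          + (-p + Complex.I * q) / 2 * w) * eab
  have c1 : Continuous fun t : ℝ => (1 - α * Complex.exp (t * Complex.I))⁻¹ :=
    Continuous.inv₀ (by fun_prop) (fun t => hne α _ nα (n1 t))
  have c2 : Continuous fun t : ℝ => (1 - β * Complex.exp (-t * Complex.I))⁻¹ :=
    Continuous.inv₀ (by fun_prop) (fun t => hne β _ nβ (n2 t))
  simp_rw [key]
  have c3 : Continuous fun t : ℝ => (1 - α * Complex.exp (t * Complex.I))⁻¹
      + (1 - β * Complex.exp (-t * Complex.I))⁻¹ := c1.add c2
  rw [intervalIntegral.integral_const_mul, intervalIntegral.integral_sub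
    (c3.intervalIntegrable _ _) (by simp), intervalIntegral.integral_add
    (c1.intervalIntegrable _ _) (c2.intervalIntegrable _ _), aux_geom α nα, aux_geom' β nβ]
  simp
  field_simp

theorem aux_den (d x : ℝ) (hd : 0 < d) : (d : ℂ) + Complex.I * (x : ℂ) ≠ 0 := by
  intro h
  have := congrArg Complex.re h
  simp at this
  linarith

theorem aux_double (d a b : ℝ) (hd : 0 < d) :
    ∫ φ in (0:ℝ)..(2 * Real.pi), ∫ θ in (0:ℝ)..(2 * Real.pi),
      1 / ((d : ℂ) + Complex.I * ((a * Real.sin θ - b * Real.sin φ : ℝ) : ℂ))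
    = ((∫ ψ in (0:ℝ)..(2 * Real.pi), 2 * Real.pi /
        Real.sqrt (d ^ 2 + a ^ 2 + b ^ 2 - 2 * a * b * Real.cos ψ) : ℝ) : ℂ) := by
  have sw : ∀ F : ℝ → ℝ → ℂ, Continuous (Function.uncurry F) →
      ∫ x in (0:ℝ)..(2 * Real.pi), ∫ y in (0:ℝ)..(2 * Real.pi), F x y =
      ∫ y in (0:ℝ)..(2 * Real.pi), ∫ x in (0:ℝ)..(2 * Real.pi), F x y := by
    intro F hF
    apply MeasureTheory.intervalIntegral_intervalIntegral_swap
    apply (hF.continuousOn.integrableOn_compact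
      ((isCompact_uIcc (a := (0:ℝ)) (b := 2 * Real.pi)).prod
        (isCompact_uIcc (a := (0:ℝ)) (b := 2 * Real.pi)))).mono_set
    exact Set.prod_mono Set.uIoc_subset_uIcc Set.uIoc_subset_uIcc
  rw [sw]
  · have : ∀ θ : ℝ, ∫ φ in (0:ℝ)..(2 * Real.pi),
        1 / ((d : ℂ) + Complex.I * ((a * Real.sin θ - b * Real.sin φ : ℝ) : ℂ))
        = ∫ ψ in (0:ℝ)..(2 * Real.pi),
        1 / ((d : ℂ) + Complex.I * ((a * Real.sin θ - b * Real.sin (θ + ψ) : ℝ) : ℂ)) := by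
      intro θ
      rw [intervalIntegral.integral_comp_add_left (fun φ =>
        1 / ((d : ℂ) + Complex.I * ((a * Real.sin θ - b * Real.sin φ : ℝ) : ℂ))) θ]
      have hper : Function.Periodic (fun φ : ℝ => 
        1 / ((d : ℂ) + Complex.I * ((a * Real.sin θ - b * Real.sin φ : ℝ) : ℂ)))
        (2 * Real.pi) := by
        intro t; simp only [Real.sin_add_two_pi]
      have := hper.intervalIntegral_add_eq 0 θ
      rw [zero_add] at this
      rw [this, add_zero]
    simp_rw [this]
    rw [sw]
    · rw [← intervalIntegral.integral_ofReal]
      congr 1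
      ext ψ
      have := aux_inner d (a - b * Real.cos ψ) (-(b * Real.sin ψ)) hd
      rw [show d ^ 2 + (a - b * Real.cos ψ) ^ 2 + (-(b * Real.sin ψ)) ^ 2
        = d ^ 2 + a ^ 2 + b ^ 2 - 2 * a * b * Real.cos ψ by
          linear_combination b ^ 2 * Real.sin_sq_add_cos_sq ψ] at this
      rw [← this]
      congr 1
      ext θ
      rw [Real.sin_add]
      congr 4
      ring
    · exact Continuous.div continuous_const (by fun_prop)
        (fun x => aux_den d _ hd)
  · exact Continuous.div continuous_const (by fun_prop)
        (fun x => aux_den d _ hd)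

theorem aux_elliptic (κ : ℝ) :
    ∫ x in (0 : ℝ)..1, 1 / Real.sqrt ((1 - x ^ 2) * (1 - κ ^ 2 * x ^ 2))
      = ∫ t in (0:ℝ)..(Real.pi / 2), 1 / Real.sqrt (1 - κ ^ 2 * Real.sin t ^ 2) := by
  have := aux_subst 1 one_pos 0 (Real.pi / 2) (by linarith [Real.pi_pos]) le_rfl
    (by linarith [Real.pi_pos])
    (fun x => 1 / Real.sqrt ((1 - x ^ 2) * (1 - κ ^ 2 * x ^ 2)))
    (fun t => 1 / Real.sqrt (1 - κ ^ 2 * Real.sin t ^ 2)) (by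
      intro t ht
      have hcos : 0 < Real.cos t := Real.cos_pos_of_mem_Ioo ⟨by linarith [ht.1, Real.pi_pos], ht.2⟩
      simp only [one_mul, smul_eq_mul]
      rw [← Real.cos_sq', Real.sqrt_mul (by positivity), Real.sqrt_sq hcos.le]
      field_simp)
  simpa using this

theorem aux_quarter (D m κ : ℝ) (hD : 0 < D) (hm : m = D ^ 2 * κ ^ 2) (hκ : κ ^ 2 < 1) :
    ∫ ψ in (0:ℝ)..(2 * Real.pi), 2 * Real.pi /
        Real.sqrt (D ^ 2 - m / 2 - m / 2 * Real.cos ψ)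
    = 8 * Real.pi / D * ∫ t in (0:ℝ)..(Real.pi / 2), 1 / Real.sqrt (1 - κ ^ 2 * Real.sin t ^ 2) := by
  let G : ℝ → ℝ := fun t => 1 / Real.sqrt (1 - κ ^ 2 * Real.cos t ^ 2)
  have hG : Continuous G := by
    apply Continuous.div continuous_const (by fun_prop)
    intro t
    apply (Real.sqrt_pos.mpr _).ne'
    nlinarith [Real.cos_sq_le_one t, sq_nonneg (Real.cos t), sq_nonneg κ]
  have h1 : ∀ ψ : ℝ, 2 * Real.pi / Real.sqrt (D ^ 2 - m / 2 - m / 2 * Real.cos ψ)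
      = 2 * Real.pi / D * G (ψ / 2) := by
    intro ψ
    have : D ^ 2 - m / 2 - m / 2 * Real.cos ψ = D ^ 2 * (1 - κ ^ 2 * Real.cos (ψ / 2) ^ 2) := by
      have := Real.cos_two_mul (ψ / 2)
      rw [show 2 * (ψ / 2) = ψ by ring] at this
      rw [this, hm]; ring
    rw [this, Real.sqrt_mul (by positivity), Real.sqrt_sq hD.le]
    simp only [G]
    rw [div_mul_div_comm, mul_one]
  simp_rw [h1]
  rw [intervalIntegral.integral_const_mul, intervalIntegral.integral_comp_div G two_ne_zero]
  rw [zero_div, show 2 * Real.pi / 2 = Real.pi by ring,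
    ← intervalIntegral.integral_add_adjacent_intervals (b := Real.pi / 2)
    (hG.intervalIntegrable _ _) (hG.intervalIntegrable _ _)]
  have h2 := intervalIntegral.integral_comp_sub_left (a := 0) (b := Real.pi / 2) G Real.pi
  have h3 := intervalIntegral.integral_comp_sub_left (a := 0) (b := Real.pi / 2) G (Real.pi / 2)
  rw [sub_zero, show Real.pi - Real.pi / 2 = Real.pi / 2 by ring] at h2
  rw [sub_zero, sub_self] at h3
  have e2 : ∀ t, G (Real.pi - t) = G t := by intro t; simp [G, Real.cos_pi_sub]
  have e3 : ∀ t, G (Real.pi / 2 - t) = 1 / Real.sqrt (1 - κ ^ 2 * Real.sin t ^ 2) := by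
    intro t; simp [G, Real.cos_pi_div_two_sub]
  simp_rw [e2] at h2
  simp_rw [e3] at h3
  rw [← h2, ← h3, smul_eq_mul]
  ring


/-- Proposition 5.2, via (5.71): the double integral expressing the limiting
covariance equals `(4κ/(π√(I₁I₂))) 𝕂(κ)` where `𝕂` is the complete elliptic integral of the
first kind and `κ = 2√(I₁I₂)/√((R₁-R₂)² + (I₁+I₂)²) ∈ (0,1)`. -/
theorem covariance_elliptic_integral (R1 R2 : ℝ) (hR : R2 < R1) (I1 I2 : ℝ)
    (hI1 : 0 < I1) (hI2 : 0 < I2) :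
    let κ : ℝ := 2 * Real.sqrt (I1 * I2) / Real.sqrt ((R1 - R2) ^ 2 + (I1 + I2) ^ 2)
    κ ∈ Set.Ioo (0 : ℝ) 1 ∧
      (4 / (Real.pi : ℂ) ^ 2) *
          ∫ X in (-I2)..I2, ∫ Y in (-I1)..I1,
            (1 / (((R1 : ℂ) - (R2 : ℂ)) + Complex.I * ((Y : ℂ) - (X : ℂ)))) *
              (1 / ((Real.sqrt (I1 ^ 2 - Y ^ 2) : ℂ) * (Real.sqrt (I2 ^ 2 - X ^ 2) : ℂ))) =
        (((4 * κ / (Real.pi * Real.sqrt (I1 * I2))) *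
          ∫ x in (0 : ℝ)..1, 1 / Real.sqrt ((1 - x ^ 2) * (1 - κ ^ 2 * x ^ 2)) : ℝ) : ℂ) := by
  intro κ
  have hd : 0 < R1 - R2 := sub_pos.mpr hR
  set d := R1 - R2 with hdd
  have hab : 0 < I1 * I2 := mul_pos hI1 hI2
  have hS : 0 < Real.sqrt (I1 * I2) := Real.sqrt_pos.mpr hab
  have hS2 : Real.sqrt (I1 * I2) ^ 2 = I1 * I2 := Real.sq_sqrt hab.le
  have hD : 0 < Real.sqrt (d ^ 2 + (I1 + I2) ^ 2) := Real.sqrt_pos.mpr (by positivity)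
  have hD2 : Real.sqrt (d ^ 2 + (I1 + I2) ^ 2) ^ 2 = d ^ 2 + (I1 + I2) ^ 2 :=
    Real.sq_sqrt (by positivity)
  have hκdef : κ = 2 * Real.sqrt (I1 * I2) / Real.sqrt (d ^ 2 + (I1 + I2) ^ 2) := rfl
  clear_value κ
  generalize Real.sqrt (d ^ 2 + (I1 + I2) ^ 2) = D at *
  generalize Real.sqrt (I1 * I2) = S at *
  have hκ0 : 0 < κ := by rw [hκdef]; positivity
  have hκ2 : D ^ 2 * κ ^ 2 = 4 * (I1 * I2) := by
    rw [hκdef]; field_simp; linear_combination 4 * hS2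
  have hκ1 : κ < 1 := by
    rw [hκdef, div_lt_one hD]
    apply lt_of_pow_lt_pow_left₀ 2 hD.le
    nlinarith [sq_nonneg (I1 - I2)]
  refine ⟨⟨hκ0, hκ1⟩, ?_⟩
  rw [aux_elliptic]
  have hq := aux_quarter D (4 * (I1 * I2)) κ hD hκ2.symm (by nlinarith)
  have hdbl := aux_double d I1 I2 hd
  have e1 : ∀ ψ, D ^ 2 - 4 * (I1 * I2) / 2 - 4 * (I1 * I2) / 2 * Real.cos ψ
    = d ^ 2 + I1 ^ 2 + I2 ^ 2 - 2 * I1 * I2 * Real.cos ψ := by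
    intro ψ; rw [hD2]; ring
  simp_rw [e1] at hq
  rw [hq] at hdbl
  -- reduce the double integral to angles
  have hin : ∀ x : ℝ, ∫ θ in (0:ℝ)..(2 * Real.pi),
      1 / ((d : ℂ) + Complex.I * ((I1 * Real.sin θ - I2 * x : ℝ) : ℂ))
      = 2 * ∫ θ in (-(Real.pi / 2))..(Real.pi / 2),
      1 / ((d : ℂ) + Complex.I * ((I1 * Real.sin θ - I2 * x : ℝ) : ℂ)) := by
    intro x
    exact aux_half (fun y => 1 / ((d : ℂ) + Complex.I * ((I1 * y - I2 * x : ℝ) : ℂ)))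
      (Continuous.div continuous_const (by fun_prop) (fun x => aux_den d _ hd))
  simp_rw [hin] at hdbl
  rw [intervalIntegral.integral_const_mul, aux_half (fun x =>
    ∫ θ in (-(Real.pi / 2))..(Real.pi / 2),
      1 / ((d : ℂ) + Complex.I * ((I1 * Real.sin θ - I2 * x : ℝ) : ℂ)))] at hdbl
  swap
  · apply intervalIntegral.continuous_parametric_intervalIntegral_of_continuous'
    exact Continuous.div continuous_const (by fun_prop) (fun x => aux_den d _ hd)
  have hout : ∫ X in (-I2)..I2, ∫ Y in (-I1)..I1,
            (1 / (((R1 : ℂ) - (R2 : ℂ)) + Complex.I * ((Y : ℂ) - (X : ℂ)))) *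
              (1 / ((Real.sqrt (I1 ^ 2 - Y ^ 2) : ℂ) * (Real.sqrt (I2 ^ 2 - X ^ 2) : ℂ)))
      = ∫ φ in (-(Real.pi / 2))..(Real.pi / 2), ∫ θ in (-(Real.pi / 2))..(Real.pi / 2),
      1 / ((d : ℂ) + Complex.I * ((I1 * Real.sin θ - I2 * Real.sin φ : ℝ) : ℂ)) := by
    rw [← aux_weight I2 hI2 (fun X => ∫ θ in (-(Real.pi / 2))..(Real.pi / 2),
      1 / ((d : ℂ) + Complex.I * ((I1 * Real.sin θ - X : ℝ) : ℂ)))]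
    congr 1
    ext X
    rw [← aux_weight I1 hI1 (fun Y => 1 / ((d : ℂ) + Complex.I * ((Y - X : ℝ) : ℂ))),
      ← intervalIntegral.integral_mul_const]
    congr 1
    ext Y
    rw [hdd]
    push_cast
    simp only [one_div, mul_inv]
    ring
  rw [hout]
  generalize (∫ φ in (-(Real.pi / 2))..(Real.pi / 2), ∫ θ in (-(Real.pi / 2))..(Real.pi / 2),
      1 / ((d : ℂ) + Complex.I * ((I1 * Real.sin θ - I2 * Real.sin φ : ℝ) : ℂ))) = J at *
  generalize (∫ t in (0:ℝ)..(Real.pi / 2), 1 / Real.sqrt (1 - κ ^ 2 * Real.sin t ^ 2)) = K at *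
  have hJ : J = ((2 * Real.pi / D * K : ℝ) : ℂ) := by
    have : (4 : ℂ) * J = 4 * ((2 * Real.pi / D * K : ℝ) : ℂ) := by
      push_cast at hdbl ⊢
      linear_combination hdbl
    exact mul_left_cancel₀ (by norm_num) this
  rw [hJ, hκdef]
  have hpi := Real.pi_pos
  have : (4 / Real.pi ^ 2) * (2 * Real.pi / D * K) = 4 * (2 * S / D) / (Real.pi * S) * K := by
    field_simp
    try ring
  exact_mod_cast this
end

section
/- Let τ > 0 be real and let ξ = (ξ_1, ξ_2) ∈ ℝ² with ξ ≠ 0, and write r² = ξ_1² + ξ_2². Then ∫_{ℝ²} (1/(2πτ)) · e^{−(σ_1²+σ_2²)/(2τ)} · log((σ_1−ξ_1)² + (σ_2−ξ_2)²) dσ_1 dσ_2 = ∫_{r²/(2τ)}^{∞} t^{−1} e^{−t} dt + log(r²). -/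
open MeasureTheory

lemma circ_aux (ξ1 ξ2 ρ : ℝ) (hρ : 0 < ρ) (h : 0 < ξ1 ^ 2 + ξ2 ^ 2) :
    IntegrableOn (fun θ : ℝ => Real.log ((ρ * Real.cos θ - ξ1) ^ 2 + (ρ * Real.sin θ - ξ2) ^ 2))
      (Set.Ioo (-Real.pi) Real.pi) ∧
    ∫ θ in Set.Ioo (-Real.pi) Real.pi,
      Real.log ((ρ * Real.cos θ - ξ1) ^ 2 + (ρ * Real.sin θ - ξ2) ^ 2) =
      2 * Real.pi * max (Real.log (ρ ^ 2)) (Real.log (ξ1 ^ 2 + ξ2 ^ 2)) := by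
  have hpi := Real.pi_pos
  set a : ℂ := ⟨ξ1, ξ2⟩ with ha
  have hn : ∀ z : ℂ, Real.log ‖z‖ = (1/2) * Real.log (z.re ^ 2 + z.im ^ 2) := by
    intro z
    rw [Complex.norm_eq_sqrt_sq_add_sq, Real.log_sqrt (by positivity)]; ring
  have key : ∀ θ : ℝ, Real.log ((ρ * Real.cos θ - ξ1) ^ 2 + (ρ * Real.sin θ - ξ2) ^ 2)
      = 2 * Real.log ‖circleMap 0 ρ θ - a‖ := by
    intro θ
    rw [hn]
    have : (circleMap 0 ρ θ - a).re = ρ * Real.cos θ - ξ1 := by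
      simp [circleMap, Complex.exp_re, ha]
    rw [this]
    have : (circleMap 0 ρ θ - a).im = ρ * Real.sin θ - ξ2 := by
      simp [circleMap, Complex.exp_im, ha]
    rw [this]; ring
  have hper : Function.Periodic (fun θ : ℝ => Real.log ‖circleMap 0 ρ θ - a‖) (2 * Real.pi) := by
    intro θ
    simp only [periodic_circleMap 0 ρ θ]
  have hci : IntervalIntegrable (fun θ : ℝ => Real.log ‖circleMap 0 ρ θ - a‖) volume 0 (2 * Real.pi) :=
    circleIntegrable_log_norm_sub_const (a := a) (c := 0) ρ
  have hci2 : IntervalIntegrable (fun θ : ℝ => Real.log ‖circleMap 0 ρ θ - a‖) volume (-Real.pi) Real.pi :=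
    hper.intervalIntegrable₀ (by positivity) hci _ _
  have hval := circleAverage_log_norm_sub_const_eq_log_radius_add_posLog (a := a) (c := 0) hρ.ne'
  simp only [key]
  constructor
  · rw [intervalIntegrable_iff_integrableOn_Ioo_of_le (by linarith)] at hci2
    exact hci2.const_mul 2
  · rw [integral_const_mul, ← integral_Ioc_eq_integral_Ioo,
      ← intervalIntegral.integral_of_le (by linarith)]
    have e := hper.intervalIntegral_add_eq (-Real.pi) 0
    rw [show -Real.pi + 2 * Real.pi = Real.pi by ring, zero_add] at e
    rw [e]
    simp only [Real.circleAverage, smul_eq_mul] at hval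
    have hnorm : Real.log ‖a‖ = (1/2) * Real.log (ξ1 ^ 2 + ξ2 ^ 2) := hn a
    have hapos : 0 < ‖a‖ := by
      rw [Complex.norm_eq_sqrt_sq_add_sq]; exact Real.sqrt_pos.2 h
    have e2 : Real.log (ρ ^ 2) = 2 * Real.log ρ := by rw [Real.log_pow]; norm_num
    rw [inv_mul_eq_iff_eq_mul₀ (by positivity)] at hval
    rw [hval, zero_sub, norm_neg, Real.posLog, Real.log_mul (by positivity) hapos.ne', Real.log_inv,
      hnorm, e2, ← max_add_add_left]
    rw [show Real.log (ξ1 ^ 2 + ξ2 ^ 2) = 2 * (1 / 2 * Real.log (ξ1 ^ 2 + ξ2 ^ 2)) by ring,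
      ← mul_max_of_nonneg _ _ (by norm_num : (0:ℝ) ≤ 2)]
    ring_nf

lemma oneD_aux (a : ℝ) (ha : 0 < a) :
    IntegrableOn (fun t : ℝ => Real.exp (-t) * max (Real.log (t / a)) 0) (Set.Ioi 0) ∧
    ∫ t in Set.Ioi 0, Real.exp (-t) * max (Real.log (t / a)) 0 =
      ∫ t in Set.Ioi a, t⁻¹ * Real.exp (-t) := by
  have hexp : IntegrableOn (fun t : ℝ => Real.exp (-t)) (Set.Ioi 0) := integrableOn_exp_neg_Ioi 0
  have hG : IntegrableOn (fun t : ℝ => Real.exp (-t) * t) (Set.Ioi 0) := by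
    have := Real.GammaIntegral_convergent (s := 2) (by norm_num)
    refine this.congr_fun (fun t ht => ?_) measurableSet_Ioi
    norm_num
  have h1 : IntegrableOn (fun t : ℝ => Real.exp (-t) * max (Real.log (t / a)) 0) (Set.Ioi 0) := by
    refine Integrable.mono' (hG.mul_const a⁻¹) (Measurable.aestronglyMeasurable (by fun_prop)) ?_
    filter_upwards [ae_restrict_mem measurableSet_Ioi] with t ht
    have ht : 0 < t := ht
    rw [Real.norm_of_nonneg (by positivity), mul_assoc]
    gcongr
    apply max_le _ (by positivity)
    have := Real.log_le_sub_one_of_pos (x := t / a) (by positivity)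
    rw [← div_eq_mul_inv]; linarith
  have hsub : Set.Ioi a ⊆ Set.Ioi 0 := Set.Ioi_subset_Ioi ha.le
  have h2 : IntegrableOn (fun t : ℝ => t⁻¹ * Real.exp (-t)) (Set.Ioi a) := by
    refine Integrable.mono' ((hexp.mono_set hsub).const_mul a⁻¹)
      (Measurable.aestronglyMeasurable (by fun_prop)) ?_
    filter_upwards [ae_restrict_mem measurableSet_Ioi] with t ht
    have ht : a < t := ht
    have : 0 < t := ha.trans ht
    rw [Real.norm_of_nonneg (by positivity)]
    gcongr
  refine ⟨h1, ?_⟩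
  have h3 : ∫ t in Set.Ioi 0, Real.exp (-t) * max (Real.log (t / a)) 0 =
      ∫ t in Set.Ioi a, Real.exp (-t) * max (Real.log (t / a)) 0 := by
    refine setIntegral_eq_of_subset_of_forall_sdiff_eq_zero measurableSet_Ioi hsub ?_
    rintro t ⟨ht, hta⟩
    have ht : 0 < t := ht
    have hta : t ≤ a := by simpa using hta
    rw [max_eq_right, mul_zero]
    exact Real.log_nonpos (by positivity) ((div_le_one ha).2 hta)
  have hlog : ∀ t ∈ Set.Ioi a, Real.exp (-t) * max (Real.log (t / a)) 0
      = Real.exp (-t) * Real.log (t / a) := by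
    intro t ht
    rw [max_eq_left (Real.log_nonneg ((one_le_div ha).2 (le_of_lt ht)))]
  have h4 : IntegrableOn (fun t : ℝ => Real.exp (-t) * Real.log (t / a)) (Set.Ioi a) :=
    (h1.mono_set hsub).congr_fun hlog measurableSet_Ioi
  rw [h3, setIntegral_congr_fun measurableSet_Ioi hlog, ← sub_eq_zero, ← integral_sub h4 h2]
  have hlim : Filter.Tendsto (fun t : ℝ => -(Real.exp (-t) * Real.log (t / a))) Filter.atTop
      (nhds 0) := by
    have b : Filter.Tendsto (fun t : ℝ => a⁻¹ * (t ^ 1 * Real.exp (-t))) Filter.atTop (nhds 0) := by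
      simpa using (Real.tendsto_pow_mul_exp_neg_atTop_nhds_zero 1).const_mul a⁻¹
    rw [← neg_zero]
    apply Filter.Tendsto.neg
    refine tendsto_of_tendsto_of_tendsto_of_le_of_le' tendsto_const_nhds b ?_ ?_
    · filter_upwards [Filter.eventually_ge_atTop a] with t ht
      exact mul_nonneg (Real.exp_pos _).le (Real.log_nonneg ((one_le_div ha).2 ht))
    · filter_upwards [Filter.eventually_ge_atTop a] with t ht
      have h0 : 0 < t := ha.trans_le ht
      have := Real.log_le_sub_one_of_pos (x := t / a) (by positivity)
      calc Real.exp (-t) * Real.log (t / a) ≤ Real.exp (-t) * (t / a) := by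
            gcongr; linarith
        _ = _ := by ring
  have := integral_Ioi_of_hasDerivAt_of_tendsto' (a := a)
    (f := fun t : ℝ => -(Real.exp (-t) * Real.log (t / a)))
    (f' := fun t : ℝ => Real.exp (-t) * Real.log (t / a) - t⁻¹ * Real.exp (-t)) (m := 0)
    (fun t ht => by
      have h0 : 0 < t := ha.trans_le ht
      have d := (((hasDerivAt_neg t).exp).mul
        (((hasDerivAt_id t).div_const a).log (div_pos h0 ha).ne')).neg
      refine HasDerivAt.congr_deriv d ?_
      simp only [id]
      field_simp
      ring) (h4.sub h2) hlim
  rw [this]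
  simp [ha.ne']

lemma radial_aux (τ : ℝ) (hτ : 0 < τ) (R : ℝ) (hR : 0 < R) :
    ∫ ρ in Set.Ioi 0, (ρ / τ) * (Real.exp (-ρ ^ 2 / (2 * τ)) *
      max (Real.log (ρ ^ 2)) (Real.log R)) =
    (∫ t in Set.Ioi (R / (2 * τ)), t⁻¹ * Real.exp (-t)) + Real.log R := by
  have him : (fun ρ : ℝ => ρ ^ 2 / (2 * τ)) '' Set.Ioi 0 = Set.Ioi 0 := by
    ext t
    simp only [Set.mem_image, Set.mem_Ioi]
    constructor
    · rintro ⟨ρ, h, rfl⟩; positivity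
    · intro ht
      refine ⟨√(2 * τ * t), by positivity, ?_⟩
      rw [Real.sq_sqrt (by positivity)]; field_simp
  have hsubst := integral_image_eq_integral_abs_deriv_smul (s := Set.Ioi (0:ℝ))
    (f := fun ρ : ℝ => ρ ^ 2 / (2 * τ)) (f' := fun ρ => ρ / τ) measurableSet_Ioi
    (fun ρ _ => by
      have := ((hasDerivAt_pow 2 ρ).div_const (2 * τ)).hasDerivWithinAt (s := Set.Ioi 0)
      refine HasDerivWithinAt.congr_deriv this ?_
      norm_num; field_simp)
    (by
      intro x hx y hy hxy
      have hx : 0 < x := hx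
      have hy : 0 < y := hy
      replace hxy : x ^ 2 / (2 * τ) = y ^ 2 / (2 * τ) := hxy
      rw [div_left_inj' (by positivity)] at hxy
      exact (pow_left_inj₀ hx.le hy.le (by norm_num)).1 hxy)
    (fun t => Real.exp (-t) * max (Real.log (2 * τ * t)) (Real.log R))
  rw [him] at hsubst
  have e1 : ∫ ρ in Set.Ioi 0, (ρ / τ) * (Real.exp (-ρ ^ 2 / (2 * τ)) *
      max (Real.log (ρ ^ 2)) (Real.log R)) =
      ∫ t in Set.Ioi 0, Real.exp (-t) * max (Real.log (2 * τ * t)) (Real.log R) := by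
    rw [hsubst]
    refine setIntegral_congr_fun measurableSet_Ioi (fun ρ hρ => ?_)
    have hρ : 0 < ρ := hρ
    simp only [smul_eq_mul]
    rw [abs_of_pos (by positivity), mul_div_cancel₀ _ (by positivity), neg_div]
  rw [e1]
  obtain ⟨i1, v1⟩ := oneD_aux (R / (2 * τ)) (by positivity)
  have e2 : ∫ t in Set.Ioi 0, Real.exp (-t) * max (Real.log (2 * τ * t)) (Real.log R) =
      ∫ t in Set.Ioi 0, (Real.exp (-t) * max (Real.log (t / (R / (2 * τ)))) 0
        + Real.exp (-t) * Real.log R) := by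
    refine setIntegral_congr_fun measurableSet_Ioi (fun t ht => ?_)
    have ht : 0 < t := ht
    rw [show t / (R / (2 * τ)) = (2 * τ * t) / R by field_simp,
      Real.log_div (by positivity) hR.ne', ← mul_add, ← max_add_add_right]
    simp
  rw [e2, integral_add i1 ((integrableOn_exp_neg_Ioi 0).mul_const _), v1, integral_mul_const,
    integral_exp_neg_Ioi_zero, one_mul]

/-- identity (5.49) combined with `C(R) = Γ(0,R²/2) + ln(R²)` from
Section 5.6: the Gaussian average of the planar logarithm equals the incomplete Gamma
function plus `log r²`. -/
theorem gaussian_log_average (τ : ℝ) (hτ : 0 < τ) (ξ1 ξ2 : ℝ) (hξ : (ξ1, ξ2) ≠ (0, 0)) :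
    (∫ σ : ℝ × ℝ,
        (1 / (2 * Real.pi * τ)) * Real.exp (-(σ.1 ^ 2 + σ.2 ^ 2) / (2 * τ)) *
          Real.log ((σ.1 - ξ1) ^ 2 + (σ.2 - ξ2) ^ 2)) =
      (∫ t in Set.Ioi ((ξ1 ^ 2 + ξ2 ^ 2) / (2 * τ)), t⁻¹ * Real.exp (-t)) +
        Real.log (ξ1 ^ 2 + ξ2 ^ 2) := by
  have hpi := Real.pi_pos
  have hR : 0 < ξ1 ^ 2 + ξ2 ^ 2 := by
    by_contra hc
    apply hξ
    have h1 : ξ1 = 0 := by nlinarith [sq_nonneg ξ1, sq_nonneg ξ2]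
    have h2 : ξ2 = 0 := by nlinarith [sq_nonneg ξ1, sq_nonneg ξ2]
    rw [h1, h2]
  rw [← radial_aux τ hτ _ hR, ← integral_comp_polarCoord_symm]
  set R := ξ1 ^ 2 + ξ2 ^ 2 with hRdef
  set L : ℝ → ℝ → ℝ := fun ρ θ =>
    Real.log ((ρ * Real.cos θ - ξ1) ^ 2 + (ρ * Real.sin θ - ξ2) ^ 2) with hL
  set w : ℝ → ℝ := fun ρ => ρ / (2 * Real.pi * τ) * Real.exp (-ρ ^ 2 / (2 * τ)) with hw
  have hform : ∀ p : ℝ × ℝ, p.1 • ((1 / (2 * Real.pi * τ)) *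
      Real.exp (-((polarCoord.symm p).1 ^ 2 + (polarCoord.symm p).2 ^ 2) / (2 * τ)) *
      Real.log (((polarCoord.symm p).1 - ξ1) ^ 2 + ((polarCoord.symm p).2 - ξ2) ^ 2))
      = w p.1 * L p.1 p.2 := by
    intro p
    have : (p.1 * Real.cos p.2) ^ 2 + (p.1 * Real.sin p.2) ^ 2 = p.1 ^ 2 := by
      have := Real.sin_sq_add_cos_sq p.2
      linear_combination p.1 ^ 2 * this
    simp only [polarCoord_symm_apply, smul_eq_mul, this, hw, hL]
    ring
  simp only [hform, polarCoord_target]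
  have hLmeas : Measurable (fun p : ℝ × ℝ => L p.1 p.2) := by
    simp only [hL]; fun_prop
  have hwmeas : Measurable w := by simp only [hw]; fun_prop
  -- integrability
  have hint : IntegrableOn (fun p : ℝ × ℝ => w p.1 * L p.1 p.2)
      (Set.Ioi 0 ×ˢ Set.Ioo (-Real.pi) Real.pi) (volume.prod volume) := by
    rw [IntegrableOn, ← Measure.prod_restrict]
    have hm : Measurable (fun p : ℝ × ℝ => w p.1 * L p.1 p.2) := by fun_prop
    rw [integrable_prod_iff hm.aestronglyMeasurable]
    constructor
    · filter_upwards [ae_restrict_mem measurableSet_Ioi] with ρ hρ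
      exact (circ_aux ξ1 ξ2 ρ hρ hR).1.const_mul _
    · set K : ℝ → ℝ := fun ρ => 2 * Real.pi * (4 * (ρ ^ 2 + R) + |Real.log R|) with hK
      have hKint : IntegrableOn (fun ρ => w ρ * K ρ) (Set.Ioi 0) := by
        have hb : 0 < 1 / (2 * τ) := by positivity
        have j3 := integrableOn_rpow_mul_exp_neg_mul_sq hb (s := 3) (by norm_num)
        have j1 := integrableOn_rpow_mul_exp_neg_mul_sq hb (s := 1) (by norm_num)
        have j4 : IntegrableOn _ (Set.Ioi (0:ℝ)) := (j3.const_mul (4 / τ)).add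
          (j1.const_mul ((4 * R + |Real.log R|) / τ))
        refine j4.congr_fun (fun ρ hρ => ?_) measurableSet_Ioi
        simp only [Pi.add_apply, hw, hK, Real.rpow_one]
        rw [show (ρ ^ (3:ℝ)) = ρ ^ 3 by exact_mod_cast Real.rpow_natCast ρ 3,
          show -ρ ^ 2 / (2 * τ) = -(1 / (2 * τ)) * ρ ^ 2 by ring]
        field_simp
        ring
      refine Integrable.mono' hKint
        (hm.stronglyMeasurable.norm.integral_prod_right).aestronglyMeasurable ?_
      filter_upwards [ae_restrict_mem measurableSet_Ioi] with ρ hρ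
      have hρ : 0 < ρ := hρ
      obtain ⟨c1, c2⟩ := circ_aux ξ1 ξ2 ρ hρ hR
      have hw0 : 0 ≤ w ρ := by simp only [hw]; positivity
      rw [Real.norm_of_nonneg (integral_nonneg fun _ => norm_nonneg _)]
      simp only [norm_mul, Real.norm_of_nonneg hw0, integral_const_mul]
      gcongr
      have hpt : ∀ θ, ‖L ρ θ‖ ≤ 4 * (ρ ^ 2 + R) - L ρ θ := by
        intro θ
        set s := (ρ * Real.cos θ - ξ1) ^ 2 + (ρ * Real.sin θ - ξ2) ^ 2 with hs
        have hs0 : 0 ≤ s := by positivity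
        have hle : Real.log s ≤ s := Real.log_le_self hs0
        have hs2 : s ≤ 2 * (ρ ^ 2 + R) := by
          have := Real.sin_sq_add_cos_sq θ
          rw [hRdef, hs]
          nlinarith [sq_nonneg (ρ * Real.cos θ + ξ1), sq_nonneg (ρ * Real.sin θ + ξ2)]
        have : L ρ θ = Real.log s := rfl
        rw [this, Real.norm_eq_abs, abs_le]
        constructor <;> linarith
      have hci : IntegrableOn (fun _ : ℝ => 4 * (ρ ^ 2 + R)) (Set.Ioo (-Real.pi) Real.pi) :=
        integrableOn_const (by simp)
      calc ∫ θ in Set.Ioo (-Real.pi) Real.pi, ‖L ρ θ‖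
          ≤ ∫ θ in Set.Ioo (-Real.pi) Real.pi, (4 * (ρ ^ 2 + R) - L ρ θ) :=
            integral_mono c1.norm (Integrable.sub hci c1) hpt
        _ = 2 * Real.pi * (4 * (ρ ^ 2 + R)) - 2 * Real.pi * max (Real.log (ρ ^ 2)) (Real.log R) := by
            rw [integral_sub hci c1, c2]
            simp only [integral_const, MeasurableSet.univ, measureReal_restrict_apply,
              Set.univ_inter, Real.volume_real_Ioo, smul_eq_mul]
            rw [max_eq_left (by linarith)]
            ring
        _ ≤ K ρ := by
            have h1 : -|Real.log R| ≤ max (Real.log (ρ ^ 2)) (Real.log R) :=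
              (neg_abs_le _).trans (le_max_right _ _)
            simp only [hK]
            nlinarith
  rw [Measure.volume_eq_prod, setIntegral_prod _ hint]
  refine setIntegral_congr_fun measurableSet_Ioi (fun ρ hρ => ?_)
  simp only [integral_const_mul]
  rw [(circ_aux ξ1 ξ2 ρ hρ hR).2]
  simp only [hw]
  rw [← hRdef]
  field_simp
end
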